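/- arXiv:1403.3558 — 12 statements merged into one kernel-verified Lean document; each statement's English description precedes it below -/
import Mathlib

section
/- Let q : [0,∞) → ℝ be continuous with q(r) ≥ 0 for all r, and suppose the improper integral ∫₀^∞ ρ q(ρ) dρ converges with ∫₀^∞ ρ q(ρ) dρ < 1. Let φ : [0,∞) → ℝ be twice continuously differentiable with φ'' + qφ = 0, φ(0) = 0 and φ'(0) = 1. Then φ'(r) ≥ 1 − ∫₀^∞ ρ q(ρ) dρ > 0 for all r ≥ 0, and φ(r) > 0 for all r > 0. -/
open MeasureTheory Set

/-- If `φ'' + q φ = 0` with `φ(0) = 0`, `φ'(0) = 1` and `q ≥ 0`, then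
`φ'(r) ≥ 1 - ∫₀^∞ ρ q(ρ) dρ` as long as `φ' ≥ 0` on `(0, r)`. -/
theorem one_sub_integral_le_deriv_of_deriv_nonneg {q φ : ℝ → ℝ}
    (hq_nonneg : ∀ r, 0 ≤ r → 0 ≤ q r)
    (hint : IntegrableOn (fun ρ => ρ * q ρ) (Ioi 0))
    (hφ : ContDiff ℝ 2 φ)
    (hODE : ∀ r, 0 ≤ r → deriv (deriv φ) r + q r * φ r = 0)
    (hφ0 : φ 0 = 0) (hφ'0 : deriv φ 0 = 1) {r : ℝ} (hr : 0 ≤ r)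
    (hpos : ∀ t ∈ Ioo 0 r, 0 ≤ deriv φ t) :
    1 - (∫ ρ in Ioi (0:ℝ), ρ * q ρ) ≤ deriv φ r := by
  have hd : Differentiable ℝ φ := hφ.differentiable (by norm_num)
  have hφ' : ContDiff ℝ 1 (deriv φ) := by
    have h : ContDiff ℝ (1 + 1) φ := by simpa [one_add_one_eq_two] using hφ
    exact (contDiff_succ_iff_deriv.1 h).2.2
  have hd' : Differentiable ℝ (deriv φ) := hφ'.differentiable (by norm_num)
  have hc'' : Continuous (deriv (deriv φ)) := hφ'.continuous_deriv le_rfl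
  have h0 : (0:ℝ) ∈ Icc 0 r := left_mem_Icc.2 hr
  have hφ_nonneg : ∀ t ∈ Icc 0 r, 0 ≤ φ t := fun t ht => by
    have hmono : MonotoneOn φ (Icc 0 r) :=
      monotoneOn_of_deriv_nonneg (convex_Icc 0 r) hd.continuous.continuousOn
        hd.differentiableOn (by simpa only [interior_Icc] using hpos)
    simpa [hφ0] using hmono h0 ht ht.1
  have hφ'_le : ∀ t ∈ Icc 0 r, deriv φ t ≤ 1 := fun t ht => by
    have hanti : AntitoneOn (deriv φ) (Icc 0 r) := by
      refine antitoneOn_of_deriv_nonpos (convex_Icc 0 r) hd'.continuous.continuousOn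
        hd'.differentiableOn fun x hx => ?_
      have hx' := interior_subset hx
      linarith [hODE x hx'.1, mul_nonneg (hq_nonneg x hx'.1) (hφ_nonneg x hx')]
    simpa [hφ'0] using hanti h0 ht ht.1
  have hφ_le : ∀ t ∈ Icc 0 r, φ t ≤ t := fun t ht => by
    have h := (convex_Icc 0 r).image_sub_le_mul_sub_of_deriv_le hd.continuous.continuousOn
      hd.differentiableOn (fun x hx => hφ'_le x (interior_subset hx)) 0 h0 t ht ht.1
    simpa [hφ0] using h
  have hftc : ∫ t in (0:ℝ)..r, -deriv (deriv φ) t = 1 - deriv φ r := by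
    rw [intervalIntegral.integral_neg, intervalIntegral.integral_deriv_eq_sub
      (fun x _ => hd' x) (hc''.intervalIntegrable 0 r), hφ'0, neg_sub]
  have hint_r : IntegrableOn (fun ρ => ρ * q ρ) (Ioc 0 r) := hint.mono_set Ioc_subset_Ioi_self
  have hle : ∫ t in (0:ℝ)..r, -deriv (deriv φ) t ≤ ∫ t in (0:ℝ)..r, t * q t := by
    refine intervalIntegral.integral_mono_on hr (hc''.neg.intervalIntegrable 0 r)
      ((intervalIntegrable_iff_integrableOn_Ioc_of_le hr).2 hint_r) fun t ht => ?_
    nlinarith [hODE t ht.1, mul_le_mul_of_nonneg_left (hφ_le t ht) (hq_nonneg t ht.1)]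
  have hle' : ∫ t in (0:ℝ)..r, t * q t ≤ ∫ ρ in Ioi (0:ℝ), ρ * q ρ := by
    rw [intervalIntegral.integral_of_le hr]
    refine setIntegral_mono_set hint ?_ Ioc_subset_Ioi_self.eventuallyLE
    filter_upwards [ae_restrict_mem measurableSet_Ioi] with t ht
    exact mul_nonneg (le_of_lt ht) (hq_nonneg t (le_of_lt ht))
  linarith

/-- If `q ≥ 0` is continuous with `∫₀^∞ ρ q(ρ) dρ < 1`, then the solution of
`φ'' + q φ = 0`, `φ(0) = 0`, `φ'(0) = 1` satisfies
`φ'(r) ≥ 1 - ∫₀^∞ ρ q(ρ) dρ > 0` for all `r ≥ 0` and `φ(r) > 0` for `r > 0`. -/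
theorem stmt_2 (q φ : ℝ → ℝ)
    (hq_cont : ContinuousOn q (Ici 0))
    (hq_nonneg : ∀ r, 0 ≤ r → 0 ≤ q r)
    (hint : IntegrableOn (fun ρ => ρ * q ρ) (Ioi 0))
    (hlt : (∫ ρ in Ioi (0:ℝ), ρ * q ρ) < 1)
    (hφ : ContDiff ℝ 2 φ)
    (hODE : ∀ r, 0 ≤ r → deriv (deriv φ) r + q r * φ r = 0)
    (hφ0 : φ 0 = 0) (hφ'0 : deriv φ 0 = 1) :
    (∀ r, 0 ≤ r → 1 - (∫ ρ in Ioi (0:ℝ), ρ * q ρ) ≤ deriv φ r) ∧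
    0 < 1 - (∫ ρ in Ioi (0:ℝ), ρ * q ρ) ∧
    (∀ r, 0 < r → 0 < φ r) := by
  have hc' : Continuous (deriv φ) := hφ.continuous_deriv (by norm_num)
  have hpos : ∀ r, 0 ≤ r → 0 < deriv φ r := by
    by_contra! hneg
    obtain ⟨r, hr, hr'⟩ := hneg
    set S : Set ℝ := Ici 0 ∩ {t | deriv φ t ≤ 0}
    have hbdd : BddBelow S := ⟨0, fun t ht => ht.1⟩
    have hmem : sInf S ∈ S :=
      (isClosed_Ici.inter (isClosed_le hc' continuous_const)).csInf_mem ⟨r, hr, hr'⟩ hbdd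
    have h := one_sub_integral_le_deriv_of_deriv_nonneg hq_nonneg hint hφ hODE hφ0 hφ'0 hmem.1
      fun t ht => by
        by_contra! hlt_zero
        exact (csInf_le hbdd ⟨ht.1.le, hlt_zero.le⟩).not_gt ht.2
    have h' : deriv φ (sInf S) ≤ 0 := hmem.2
    linarith
  refine ⟨fun r hr => one_sub_integral_le_deriv_of_deriv_nonneg hq_nonneg hint hφ hODE hφ0 hφ'0 hr
    fun t ht => (hpos t ht.1.le).le, sub_pos.2 hlt, fun r hr => ?_⟩
  have hmono : StrictMonoOn φ (Ici 0) :=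
    strictMonoOn_of_deriv_pos (convex_Ici 0) hφ.continuous.continuousOn
      fun x hx => hpos x (interior_subset hx)
  simpa [hφ0] using hmono self_mem_Ici hr.le hr
end

section
/- Let κ : [0,∞) → ℝ be continuous with inf_{r ≥ 0} H(r) > −∞, where H(r) := ∫₀^r κ(ρ) dρ, and let q : [0,∞) → ℝ be continuous with q ≥ 0. Suppose that the improper integral ∫₀^∞ (∫₀^r e^{H(ρ)} dρ) e^{−H(r)} q(r) dr converges and is < 1. Then every twice continuously differentiable φ : [0,∞) → ℝ satisfying φ'' − κφ' + qφ = 0, φ(0) = 0 and φ'(0) = 1 satisfies φ(r) > 0 and φ'(r) > 0 for all r > 0. -/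
open MeasureTheory Set

/-- A function on the line with nonnegative derivative on `[0, b]` does not
decrease between points of `[0, b]`. -/
lemma le_of_hasDerivWithinAt_nonneg {f f' : ℝ → ℝ} {b : ℝ}
    (hf : ∀ x, 0 ≤ x → x ≤ b → HasDerivWithinAt f (f' x) (Ici 0) x)
    (hf' : ∀ x, 0 < x → x < b → 0 ≤ f' x) {x y : ℝ} (hx : 0 ≤ x) (hxy : x ≤ y) (hy : y ≤ b) :
    f x ≤ f y := by
  have hd : ∀ z ∈ interior (Icc (0:ℝ) b), HasDerivAt f (f' z) z := by
    intro z hz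
    rw [interior_Icc] at hz
    exact (hf z hz.1.le hz.2.le).hasDerivAt (Ici_mem_nhds hz.1)
  refine monotoneOn_of_deriv_nonneg (convex_Icc 0 b)
    (fun z hz => ((hf z hz.1 hz.2).continuousWithinAt).mono Icc_subset_Ici_self)
    (fun z hz => (hd z hz).differentiableAt.differentiableWithinAt) ?_
    ⟨hx, hxy.trans hy⟩ ⟨hx.trans hxy, hy⟩ hxy
  intro z hz
  rw [(hd z hz).deriv]
  rw [interior_Icc] at hz
  exact hf' z hz.1 hz.2

/-- The primitive from `0` of a function continuous on `[0, ∞)` is differentiable there. -/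
lemma hasDerivWithinAt_primitive {f F : ℝ → ℝ} (hf : ContinuousOn f (Ici 0))
    (hF : ∀ r, F r = ∫ ρ in (0:ℝ)..r, f ρ) {x : ℝ} (hx : 0 ≤ x) :
    HasDerivWithinAt F (f x) (Ici 0) x := by
  have hg : Continuous fun y => f (max 0 y) :=
    hf.comp_continuous (by fun_prop) fun y => le_max_left 0 y
  have hd := (hg.integral_hasStrictDerivAt 0 x).hasDerivAt.hasDerivWithinAt (s := Ici 0)
  rw [max_eq_right hx] at hd
  have heq : ∀ y ∈ Ici (0:ℝ), F y = ∫ ρ in (0:ℝ)..y, f (max 0 ρ) := by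
    intro y hy
    rw [hF]
    refine intervalIntegral.integral_congr fun z hz => ?_
    rw [uIcc_of_le hy] at hz
    simp only [max_eq_right hz.1]
  exact hd.congr heq (heq x hx)


/-- Global positivity of the conformal factor: if `H = ∫₀^· κ` is bounded
below, `q ≥ 0`, and `∫₀^∞ s(r) e^{-H(r)} q(r) dr < 1` where
`s(r) = ∫₀^r e^{H}`, then any solution of `φ'' - κ φ' + q φ = 0` with
`φ(0) = 0`, `φ'(0) = 1` satisfies `φ > 0` and `φ' > 0` on `(0,∞)`. -/
theorem stmt_5 (κ q : ℝ → ℝ)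
    (hκ : ContinuousOn κ (Ici 0))
    (H s : ℝ → ℝ)
    (hH : ∀ r, H r = ∫ ρ in (0:ℝ)..r, κ ρ)
    (hs : ∀ r, s r = ∫ ρ in (0:ℝ)..r, Real.exp (H ρ))
    (hbdd : ∃ m : ℝ, ∀ r, 0 ≤ r → m ≤ H r)
    (hq_cont : ContinuousOn q (Ici 0))
    (hq_nonneg : ∀ r, 0 ≤ r → 0 ≤ q r)
    (hint : IntegrableOn (fun r => s r * Real.exp (-H r) * q r) (Ioi 0))
    (hlt : (∫ r in Ioi (0:ℝ), s r * Real.exp (-H r) * q r) < 1) :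
    ∀ φ : ℝ → ℝ, ContDiff ℝ 2 φ →
      (∀ r, 0 ≤ r → deriv (deriv φ) r - κ r * deriv φ r + q r * φ r = 0) →
      φ 0 = 0 → deriv φ 0 = 1 →
      ∀ r, 0 < r → 0 < φ r ∧ 0 < deriv φ r := by
  intro φ hφ hode hφ0 hφ0' r hr
  have hHd : ∀ x, 0 ≤ x → HasDerivWithinAt H (κ x) (Ici 0) x :=
    fun x hx => hasDerivWithinAt_primitive hκ hH hx
  have hHc : ContinuousOn H (Ici 0) := fun x hx => (hHd x hx).continuousWithinAt
  have hsd : ∀ x, 0 ≤ x → HasDerivWithinAt s (Real.exp (H x)) (Ici 0) x :=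
    fun x hx => hasDerivWithinAt_primitive hHc.rexp hs hx
  have hsc : ContinuousOn s (Ici 0) := fun x hx => (hsd x hx).continuousWithinAt
  have hH0 : H 0 = 0 := by simp [hH]
  have hs0 : s 0 = 0 := by simp [hs]
  have hs_nonneg : ∀ x, 0 ≤ x → 0 ≤ s x := fun x hx => by
    rw [hs]
    exact intervalIntegral.integral_nonneg hx fun y _ => (Real.exp_pos _).le
  set G : ℝ → ℝ := fun x => ∫ ρ in (0:ℝ)..x, s ρ * Real.exp (-H ρ) * q ρ with hG
  have hGd : ∀ x, 0 ≤ x → HasDerivWithinAt G (s x * Real.exp (-H x) * q x) (Ici 0) x :=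
    fun x hx => hasDerivWithinAt_primitive ((hsc.mul hHc.neg.rexp).mul hq_cont) (fun _ => rfl) hx
  have hG0 : G 0 = 0 := by simp [hG]
  have hG1 : ∀ x, 0 ≤ x → G x < 1 := by
    intro x hx
    refine lt_of_le_of_lt ?_ hlt
    simp only [hG]
    rw [intervalIntegral.integral_of_le hx]
    refine setIntegral_mono_set hint ?_ (Ioc_subset_Ioi_self.eventuallyLE)
    refine (ae_restrict_iff' measurableSet_Ioi).2 (Filter.Eventually.of_forall fun y hy => ?_)
    have hy0 : (0:ℝ) ≤ y := le_of_lt hy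
    exact mul_nonneg (mul_nonneg (hs_nonneg y hy0) (Real.exp_pos _).le) (hq_nonneg y hy0)
  have hφd : ∀ x, HasDerivAt φ (deriv φ x) x :=
    fun x => (hφ.differentiable (by norm_num) x).hasDerivAt
  have hφ1 : ContDiff ℝ 1 (deriv φ) := by
    have h2 : ContDiff ℝ (1 + 1) φ := by simpa [one_add_one_eq_two] using hφ
    exact (contDiff_succ_iff_deriv.1 h2).2.2
  have hφd' : ∀ x, HasDerivAt (deriv φ) (deriv (deriv φ) x) x :=
    fun x => (hφ1.differentiable (by norm_num) x).hasDerivAt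
  set ψ : ℝ → ℝ := fun x => Real.exp (-H x) * deriv φ x with hψ
  have hψd : ∀ x, 0 ≤ x →
      HasDerivWithinAt ψ (-(Real.exp (-H x) * q x * φ x)) (Ici 0) x := by
    intro x hx
    have h := ((hHd x hx).neg.exp).mul (hφd' x).hasDerivWithinAt
    refine h.congr_deriv ?_
    simp only [Pi.neg_apply]
    linear_combination Real.exp (-H x) * hode x hx
  have hψ0 : ψ 0 = 1 := by simp [hψ, hH0, hφ0']
  have hψφ : ∀ x, deriv φ x = Real.exp (H x) * ψ x := fun x => by
    simp only [hψ]
    rw [← mul_assoc, ← Real.exp_add, add_neg_cancel, Real.exp_zero, one_mul]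
  have hψ_pos : ∀ x, 0 ≤ x → 0 < ψ x := by
    by_contra! hcon
    obtain ⟨a, ha, hψa⟩ := hcon
    have hψc : ContinuousOn ψ (Icc 0 a) :=
      fun x hx => (hψd x hx.1).continuousWithinAt.mono Icc_subset_Ici_self
    have hcomp : IsCompact (Icc 0 a ∩ ψ ⁻¹' Iic 0) :=
      isCompact_Icc.of_isClosed_subset
        (hψc.preimage_isClosed_of_isClosed isClosed_Icc isClosed_Iic) inter_subset_left
    obtain ⟨b, ⟨hb, hψb⟩, hleast⟩ := hcomp.exists_isLeast ⟨a, ⟨ha, le_rfl⟩, hψa⟩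
    have hbefore : ∀ x, 0 ≤ x → x < b → 0 < ψ x := by
      intro x hx hxb
      by_contra! hneg
      exact absurd (hleast ⟨⟨hx, hxb.le.trans hb.2⟩, hneg⟩) (not_le.2 hxb)
    have hφ_nonneg : ∀ x, 0 ≤ x → x ≤ b → 0 ≤ φ x := by
      intro x hx hxb
      rw [← hφ0]
      refine le_of_hasDerivWithinAt_nonneg (b := b) (fun y _ _ => (hφd y).hasDerivWithinAt)
        (fun y hy hyb => ?_) le_rfl hx hxb
      rw [hψφ]
      exact mul_nonneg (Real.exp_pos _).le (hbefore y hy.le hyb).le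
    have hψ_le : ∀ x, 0 ≤ x → x ≤ b → ψ x ≤ 1 := by
      intro x hx hxb
      have h := le_of_hasDerivWithinAt_nonneg (b := b) (fun y hy _ => (hψd y hy).neg)
        (fun y hy hyb => by
          rw [neg_neg]
          exact mul_nonneg (mul_nonneg (Real.exp_pos _).le (hq_nonneg y hy.le))
            (hφ_nonneg y hy.le hyb.le)) le_rfl hx hxb
      simp only [Pi.neg_apply, hψ0] at h
      linarith
    have hφ_le : ∀ x, 0 ≤ x → x ≤ b → φ x ≤ s x := by
      intro x hx hxb
      have h := le_of_hasDerivWithinAt_nonneg (b := b)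
        (fun y hy _ => (hsd y hy).sub (hφd y).hasDerivWithinAt)
        (fun y hy hyb => by
          rw [hψφ, sub_nonneg]
          exact mul_le_of_le_one_right (Real.exp_pos _).le (hψ_le y hy.le hyb.le)) le_rfl hx hxb
      simp only [Pi.sub_apply, hs0, hφ0] at h
      linarith
    have h := le_of_hasDerivWithinAt_nonneg (b := b) (fun y hy _ => (hψd y hy).add (hGd y hy))
      (fun y hy hyb => by
        have h1 := mul_nonneg (mul_nonneg (Real.exp_pos (-H y)).le (hq_nonneg y hy.le))
          (sub_nonneg.2 (hφ_le y hy.le hyb.le))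
        linarith) le_rfl hb.1 le_rfl
    simp only [Pi.add_apply, hψ0, hG0] at h
    have h1 := hG1 b hb.1
    have h2 : ψ b ≤ 0 := hψb
    linarith
  have hφ'_pos : ∀ x, 0 ≤ x → 0 < deriv φ x := fun x hx => by
    rw [hψφ]
    exact mul_pos (Real.exp_pos _) (hψ_pos x hx)
  refine ⟨?_, hφ'_pos r hr.le⟩
  rw [← hφ0]
  refine strictMonoOn_of_deriv_pos (convex_Ici 0) hφ.continuous.continuousOn
    (fun x hx => ?_) self_mem_Ici hr.le hr
  rw [interior_Ici] at hx
  exact hφ'_pos x (le_of_lt hx)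
end

section
/- Let Q : [0,∞) → ℝ be continuous with Q ≥ 0, and let ψ : [0,∞) → ℝ be twice continuously differentiable with ψ'' + Qψ = 0, ψ(0) = 0, ψ'(0) = 1 and ψ(σ) ≥ 0 for all σ. If ∫₀^∞ Q(σ)ψ(σ) dσ < ∞, then lim_{σ→∞} ψ'(σ) and lim_{σ→∞} ψ(σ)/σ both exist and are equal to 1 − ∫₀^∞ Q(σ)ψ(σ) dσ. -/
open MeasureTheory Set

/-- If the derivative of `f` tends to `L` at infinity, then so does `f x / x`. -/
theorem tendsto_div_self_of_tendsto_deriv {f : ℝ → ℝ} {L : ℝ} (hf : Differentiable ℝ f)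
    (h : Filter.Tendsto (deriv f) Filter.atTop (nhds L)) :
    Filter.Tendsto (fun x => f x / x) Filter.atTop (nhds L) := by
  rw [Metric.tendsto_atTop] at h ⊢
  intro ε hε
  obtain ⟨N, hN⟩ := h (ε / 2) (half_pos hε)
  set C := |f N - L * N| + ε / 2 * |N| with hC
  have hC0 : 0 ≤ C := by positivity
  refine ⟨max (max N 1) (2 * C / ε + 1), fun x hx => ?_⟩
  have hxN : N ≤ x := ((le_max_left _ _).trans (le_max_left _ _)).trans hx
  have hx1 : 1 ≤ x := ((le_max_right _ _).trans (le_max_left _ _)).trans hx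
  have hxC : 2 * C / ε < x := (lt_add_one _).trans_le ((le_max_right _ _).trans hx)
  have hx0 : 0 < x := one_pos.trans_le hx1
  have hderiv : ∀ y ∈ Ici N,
      HasDerivWithinAt (fun y => f y - L * y) (deriv f y - L) (Ici N) y := fun y _ => by
    simpa using ((hf y).hasDerivAt.fun_sub ((hasDerivAt_id y).const_mul L)).hasDerivWithinAt
  have key := (convex_Ici N).norm_image_sub_le_of_norm_hasDerivWithin_le hderiv
    (fun y hy => (hN y hy).le) self_mem_Ici hxN
  simp only [Real.norm_eq_abs, abs_of_nonneg (sub_nonneg.2 hxN)] at key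
  rw [div_lt_iff₀ hε] at hxC
  have hbound : |f x - L * x| ≤ C + ε / 2 * x := by
    have h1 := abs_sub_abs_le_abs_sub (f x - L * x) (f N - L * N)
    have h2 := mul_le_mul_of_nonneg_left (neg_abs_le N) (half_pos hε).le
    linarith
  have hdiv : f x / x - L = (f x - L * x) / x := by field_simp
  rw [Real.dist_eq, hdiv, abs_div, abs_of_pos hx0, div_lt_iff₀ hx0]
  linarith

/-- If `ψ'' + Q ψ = 0`, `ψ(0) = 0`, `ψ'(0) = 1`, with `Q ≥ 0`, `ψ ≥ 0` and
`∫₀^∞ Q ψ < ∞`, then `ψ'(σ)` and `ψ(σ)/σ` both converge to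
`1 - ∫₀^∞ Q ψ` as `σ → ∞`. -/
theorem stmt_6 (Q ψ : ℝ → ℝ)
    (hQ_cont : ContinuousOn Q (Ici 0))
    (hQ_nonneg : ∀ σ, 0 ≤ σ → 0 ≤ Q σ)
    (hψ : ContDiff ℝ 2 ψ)
    (hODE : ∀ σ, 0 ≤ σ → deriv (deriv ψ) σ + Q σ * ψ σ = 0)
    (hψ0 : ψ 0 = 0) (hψ'0 : deriv ψ 0 = 1)
    (hψ_nonneg : ∀ σ, 0 ≤ σ → 0 ≤ ψ σ)
    (hint : IntegrableOn (fun σ => Q σ * ψ σ) (Ioi 0)) :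
    Filter.Tendsto (deriv ψ) Filter.atTop
      (nhds (1 - ∫ σ in Ioi (0:ℝ), Q σ * ψ σ)) ∧
    Filter.Tendsto (fun σ => ψ σ / σ) Filter.atTop
      (nhds (1 - ∫ σ in Ioi (0:ℝ), Q σ * ψ σ)) := by
  have hC1 : ContDiff ℝ 1 (deriv ψ) := hψ.deriv'
  have hderiv : Filter.Tendsto (deriv ψ) Filter.atTop
      (nhds (1 - ∫ σ in Ioi (0:ℝ), Q σ * ψ σ)) := by
    refine ((intervalIntegral_tendsto_integral_Ioi 0 hint Filter.tendsto_id).const_sub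
      1).congr' ?_
    filter_upwards [Filter.eventually_ge_atTop 0] with x hx
    have hftc : ∫ σ in (0:ℝ)..x, deriv (deriv ψ) σ = deriv ψ x - deriv ψ 0 :=
      intervalIntegral.integral_deriv_eq_sub
        (fun y _ => (hC1.differentiable one_ne_zero) y)
        ((hC1.continuous_deriv le_rfl).intervalIntegrable 0 x)
    have hcongr : ∫ σ in (0:ℝ)..x, deriv (deriv ψ) σ = ∫ σ in (0:ℝ)..x, -(Q σ * ψ σ) :=
      intervalIntegral.integral_congr fun y hy => by
        rw [uIcc_of_le hx] at hy
        exact eq_neg_of_add_eq_zero_left (hODE y hy.1)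
    rw [intervalIntegral.integral_neg, hftc, hψ'0] at hcongr
    simp only [id]
    linarith
  exact ⟨hderiv, tendsto_div_self_of_tendsto_deriv (hψ.differentiable two_ne_zero) hderiv⟩
end

section
/- Let κ : [0,∞) → ℝ be continuous with inf_{r ≥ 0} H(r) > −∞, where H(r) := ∫₀^r κ(ρ) dρ, set s(r) := ∫₀^r e^{H(ρ)} dρ and let r(·) denote the inverse of s. Let q : [0,∞) → ℝ be continuous with q ≥ 0, assume I := ∫₀^∞ s(r) e^{−H(r)} q(r) dr converges with I < 1, and let φ : [0,∞) → ℝ be twice continuously differentiable with φ'' − κφ' + qφ = 0, φ(0) = 0, φ'(0) = 1. Then φ(r) ≤ s(r) for all r ≥ 0, the limit L := lim_{σ→∞} φ(r(σ))/σ exists, and L ≥ 1 − I > 0. -/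
open MeasureTheory Set

theorem le_of_hasDerivAt_nonneg {f f' : ℝ → ℝ} {a b : ℝ} (hab : a ≤ b)
    (hf : ∀ x ∈ Icc a b, HasDerivAt f (f' x) x) (hf' : ∀ x ∈ Ioo a b, 0 ≤ f' x) :
    f a ≤ f b := by
  refine monotoneOn_of_hasDerivWithinAt_nonneg (f' := f') (convex_Icc a b)
    (fun x hx => (hf x hx).continuousAt.continuousWithinAt) (fun x hx => ?_) (fun x hx => ?_)
    (left_mem_Icc.2 hab) (right_mem_Icc.2 hab) hab
  · exact (hf x (interior_subset hx)).hasDerivWithinAt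
  · rw [interior_Icc] at hx
    exact hf' x hx

/-- Let `φ' = E ψ`, `ψ' = -p φ` with `φ 0 = 0`, `ψ 0 = 1`, let `s` be the solution `φ` for
`p = 0`, and `P' = p s` with `P 0 = 0`. If `ψ > 0` before `T`, then `0 ≤ φ T ≤ s T` and
`1 - P T ≤ ψ T`. -/
theorem bounds_of_pos_before {E p s φ ψ P : ℝ → ℝ} {T : ℝ} (hT : 0 ≤ T)
    (hE : ∀ r, 0 ≤ r → 0 < E r) (hp : ∀ r, 0 ≤ r → 0 ≤ p r)
    (hs : ∀ r, 0 ≤ r → HasDerivAt s (E r) r)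
    (hφ : ∀ r, 0 ≤ r → HasDerivAt φ (E r * ψ r) r)
    (hψ : ∀ r, 0 ≤ r → HasDerivAt ψ (-(p r * φ r)) r)
    (hP : ∀ r, 0 ≤ r → HasDerivAt P (p r * s r) r)
    (hs0 : s 0 = 0) (hφ0 : φ 0 = 0) (hψ0 : ψ 0 = 1) (hP0 : P 0 = 0)
    (hpos : ∀ r, 0 ≤ r → r < T → 0 < ψ r) :
    0 ≤ φ T ∧ φ T ≤ s T ∧ 1 - P T ≤ ψ T := by
  have hφ_nonneg : ∀ r, 0 ≤ r → r ≤ T → 0 ≤ φ r := fun r hr hrT => by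
    have := le_of_hasDerivAt_nonneg hr (fun x hx => hφ x hx.1)
      (fun x hx => (mul_pos (hE x hx.1.le) (hpos x hx.1.le (hx.2.trans_le hrT))).le)
    rwa [hφ0] at this
  have hψ_le : ∀ r, 0 ≤ r → r ≤ T → ψ r ≤ 1 := fun r hr hrT => by
    have := le_of_hasDerivAt_nonneg hr (fun x hx => (hψ x hx.1).neg)
      (fun x hx => by
        rw [neg_neg]
        exact mul_nonneg (hp x hx.1.le) (hφ_nonneg x hx.1.le (hx.2.le.trans hrT)))
    simp only [Pi.neg_apply] at this
    linarith
  have hφ_le : ∀ r, 0 ≤ r → r ≤ T → φ r ≤ s r := fun r hr hrT => by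
    have := le_of_hasDerivAt_nonneg hr (fun x hx => (hs x hx.1).sub (hφ x hx.1))
      (fun x hx => by nlinarith [hE x hx.1.le, hψ_le x hx.1.le (hx.2.le.trans hrT)])
    simp only [Pi.sub_apply] at this
    linarith
  refine ⟨hφ_nonneg T hT le_rfl, hφ_le T hT le_rfl, ?_⟩
  have := le_of_hasDerivAt_nonneg hT (fun x hx => (hψ x hx.1).add (hP x hx.1))
    (fun x hx => by nlinarith [hp x hx.1.le, hφ_le x hx.1.le hx.2.le])
  simp only [Pi.add_apply] at this
  linarith

/-- If `P ≤ I < 1` in the setting of `bounds_of_pos_before`, the bounds hold for all times. -/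
theorem bounds_of_lt_one {E p s φ ψ P : ℝ → ℝ} {I : ℝ}
    (hE : ∀ r, 0 ≤ r → 0 < E r) (hp : ∀ r, 0 ≤ r → 0 ≤ p r)
    (hs : ∀ r, 0 ≤ r → HasDerivAt s (E r) r)
    (hφ : ∀ r, 0 ≤ r → HasDerivAt φ (E r * ψ r) r)
    (hψ : ∀ r, 0 ≤ r → HasDerivAt ψ (-(p r * φ r)) r)
    (hP : ∀ r, 0 ≤ r → HasDerivAt P (p r * s r) r)
    (hs0 : s 0 = 0) (hφ0 : φ 0 = 0) (hψ0 : ψ 0 = 1) (hP0 : P 0 = 0)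
    (hPI : ∀ r, 0 ≤ r → P r ≤ I) (hI : I < 1) {r : ℝ} (hr : 0 ≤ r) :
    0 ≤ φ r ∧ φ r ≤ s r ∧ 1 - I ≤ ψ r := by
  have hpos : ∀ r, 0 ≤ r → 0 < ψ r := by
    by_contra! hcon
    obtain ⟨a, ha, hψa⟩ := hcon
    have hcont : ContinuousOn ψ (Icc 0 a) := fun x hx =>
      (hψ x hx.1).continuousAt.continuousWithinAt
    have hcomp : IsCompact (Icc 0 a ∩ ψ ⁻¹' Iic 0) :=
      isCompact_Icc.of_isClosed_subset
        (hcont.preimage_isClosed_of_isClosed isClosed_Icc isClosed_Iic) inter_subset_left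
    obtain ⟨T, ⟨hT, hψT⟩, hmin⟩ := hcomp.exists_isLeast ⟨a, ⟨ha, le_rfl⟩, hψa⟩
    have h := (bounds_of_pos_before hT.1 hE hp hs hφ hψ hP hs0 hφ0 hψ0 hP0
      fun r hr hrT => not_le.1 fun hle =>
        hrT.not_ge (hmin ⟨⟨hr, hrT.le.trans hT.2⟩, hle⟩)).2.2
    have := hPI T hT.1
    have : ψ T ≤ 0 := hψT
    linarith
  have h := bounds_of_pos_before hr hE hp hs hφ hψ hP hs0 hφ0 hψ0 hP0 fun r hr _ => hpos r hr
  exact ⟨h.1, h.2.1, by linarith [hPI r hr]⟩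

/-- The mean slope `φ / s` is antitone when the slope `ψ = dφ / ds` is. -/
theorem antitoneOn_div_of_slope {E p s φ ψ : ℝ → ℝ}
    (hE : ∀ r, 0 ≤ r → 0 < E r) (hp : ∀ r, 0 ≤ r → 0 ≤ p r)
    (hs : ∀ r, 0 ≤ r → HasDerivAt s (E r) r)
    (hφ : ∀ r, 0 ≤ r → HasDerivAt φ (E r * ψ r) r)
    (hψ : ∀ r, 0 ≤ r → HasDerivAt ψ (-(p r * φ r)) r)
    (hs0 : s 0 = 0) (hφ0 : φ 0 = 0) (hφ_nonneg : ∀ r, 0 ≤ r → 0 ≤ φ r)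
    (hs_pos : ∀ r, 0 < r → 0 < s r) :
    AntitoneOn (fun r => φ r / s r) (Ioi 0) := by
  intro a ha b _ hab
  have hslope : ∀ r, 0 < r → ψ r * s r ≤ φ r := fun r hr => by
    have := le_of_hasDerivAt_nonneg hr.le
      (fun x hx => (hφ x hx.1).sub ((hψ x hx.1).mul (hs x hx.1)))
      (fun x hx => by
        have := mul_nonneg (mul_nonneg (hp x hx.1.le) (hφ_nonneg x hx.1.le)) (hs_pos x hx.1).le
        linarith)
    simp only [Pi.sub_apply, Pi.mul_apply, hs0, hφ0] at this
    linarith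
  have hpos : ∀ x ∈ Icc a b, 0 < x := fun x hx => lt_of_lt_of_le ha hx.1
  have := le_of_hasDerivAt_nonneg hab
    (fun x hx => ((hφ x (hpos x hx).le).div (hs x (hpos x hx).le) (hs_pos x (hpos x hx)).ne').neg)
    (fun x hx => by
      have hx0 := hpos x (Ioo_subset_Icc_self hx)
      rw [← neg_div]
      refine div_nonneg ?_ (sq_nonneg _)
      nlinarith [hE x hx0.le, hslope x hx0])
  simp only [Pi.neg_apply, Pi.div_apply] at this
  exact neg_le_neg_iff.1 this

theorem ContinuousOn.continuous_comp_max {f : ℝ → ℝ} (hf : ContinuousOn f (Ici 0)) :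
    Continuous fun x => f (max 0 x) :=
  hf.comp_continuous (by fun_prop) fun _ => mem_Ici.2 (le_max_left _ _)

theorem intervalIntegral_comp_max {f : ℝ → ℝ} {r : ℝ} (hr : 0 ≤ r) :
    ∫ x in (0 : ℝ)..r, f (max 0 x) = ∫ x in (0 : ℝ)..r, f x := by
  refine intervalIntegral.integral_congr fun x hx => ?_
  rw [uIcc_of_le hr] at hx
  simp only [max_eq_right hx.1]

theorem exists_tendsto_atTop_of_antitoneOn {f : ℝ → ℝ} {a c : ℝ} (hf : AntitoneOn f (Ici a))
    (hc : ∀ x ∈ Ici a, c ≤ f x) :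
    ∃ L, Filter.Tendsto f Filter.atTop (nhds L) ∧ c ≤ L := by
  have hanti : Antitone fun x => f (max a x) := fun x y hxy =>
    hf (mem_Ici.2 (le_max_left _ _)) (mem_Ici.2 (le_max_left _ _)) (max_le_max_left a hxy)
  have hlow : ∀ x, c ≤ f (max a x) := fun x => hc _ (mem_Ici.2 (le_max_left _ _))
  refine ⟨⨅ x, f (max a x), ?_, le_ciInf hlow⟩
  refine (tendsto_atTop_ciInf hanti ⟨c, forall_mem_range.2 hlow⟩).congr' ?_
  filter_upwards [Filter.eventually_ge_atTop a] with x hx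
  rw [max_eq_right hx]

/-- Under the global-existence condition `I = ∫₀^∞ s e^{-H} q < 1`, the
solution of `φ'' - κ φ' + q φ = 0`, `φ(0) = 0`, `φ'(0) = 1` satisfies
`φ(r) ≤ s(r)`, and `φ(r(σ))/σ` converges to some `L ≥ 1 - I > 0`, where
`r(·)` is the inverse of `s`. -/
theorem stmt_7 (κ q φ rf : ℝ → ℝ)
    (hκ : ContinuousOn κ (Ici 0))
    (H s : ℝ → ℝ)
    (hH : ∀ r, H r = ∫ ρ in (0:ℝ)..r, κ ρ)
    (hs : ∀ r, s r = ∫ ρ in (0:ℝ)..r, Real.exp (H ρ))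
    (hbdd : ∃ m : ℝ, ∀ r, 0 ≤ r → m ≤ H r)
    (hrf_nonneg : ∀ σ, 0 ≤ σ → 0 ≤ rf σ)
    (hrf_right : ∀ σ, 0 ≤ σ → s (rf σ) = σ)
    (hrf_left : ∀ r, 0 ≤ r → rf (s r) = r)
    (hq_cont : ContinuousOn q (Ici 0))
    (hq_nonneg : ∀ r, 0 ≤ r → 0 ≤ q r)
    (hint : IntegrableOn (fun r => s r * Real.exp (-H r) * q r) (Ioi 0))
    (hlt : (∫ r in Ioi (0:ℝ), s r * Real.exp (-H r) * q r) < 1)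
    (hφ : ContDiff ℝ 2 φ)
    (hODE : ∀ r, 0 ≤ r → deriv (deriv φ) r - κ r * deriv φ r + q r * φ r = 0)
    (hφ0 : φ 0 = 0) (hφ'0 : deriv φ 0 = 1) :
    (∀ r, 0 ≤ r → φ r ≤ s r) ∧
    ∃ L : ℝ, Filter.Tendsto (fun σ => φ (rf σ) / σ) Filter.atTop (nhds L) ∧
      1 - (∫ r in Ioi (0:ℝ), s r * Real.exp (-H r) * q r) ≤ L ∧
      0 < 1 - (∫ r in Ioi (0:ℝ), s r * Real.exp (-H r) * q r) := by
  set I := ∫ r in Ioi (0 : ℝ), s r * Real.exp (-H r) * q r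
  let Hc : ℝ → ℝ := fun r => ∫ x in (0 : ℝ)..r, κ (max 0 x)
  let sc : ℝ → ℝ := fun r => ∫ x in (0 : ℝ)..r, Real.exp (Hc x)
  let p : ℝ → ℝ := fun r => Real.exp (-Hc r) * q (max 0 r)
  let P : ℝ → ℝ := fun r => ∫ x in (0 : ℝ)..r, p x * sc x
  let ψ : ℝ → ℝ := fun r => Real.exp (-Hc r) * deriv φ r
  have hHc : ∀ r, 0 ≤ r → Hc r = H r := fun r hr => by
    rw [hH]; exact intervalIntegral_comp_max hr
  have hsc : ∀ r, 0 ≤ r → sc r = s r := fun r hr => by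
    rw [hs]
    refine intervalIntegral.integral_congr fun x hx => ?_
    rw [uIcc_of_le hr] at hx
    simp only [hHc x hx.1]
  have dH : ∀ r, HasDerivAt Hc (κ (max 0 r)) r := fun r =>
    hκ.continuous_comp_max.integral_hasStrictDerivAt 0 r |>.hasDerivAt
  have cH : Continuous Hc := continuous_iff_continuousAt.2 fun r => (dH r).continuousAt
  have ds : ∀ r, HasDerivAt sc (Real.exp (Hc r)) r := fun r =>
    (Real.continuous_exp.comp cH).integral_hasStrictDerivAt 0 r |>.hasDerivAt
  have cs : Continuous sc := continuous_iff_continuousAt.2 fun r => (ds r).continuousAt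
  have cp : Continuous p := (Real.continuous_exp.comp cH.neg).mul hq_cont.continuous_comp_max
  have dP : ∀ r, HasDerivAt P (p r * sc r) r := fun r =>
    (cp.mul cs).integral_hasStrictDerivAt 0 r |>.hasDerivAt
  have dφ : ∀ r, HasDerivAt φ (Real.exp (Hc r) * ψ r) r := fun r => by
    have h := (hφ.differentiable (by norm_num) r).hasDerivAt
    rwa [← one_mul (deriv φ r), ← Real.exp_zero, ← add_neg_cancel (Hc r), Real.exp_add,
      mul_assoc] at h
  have dψ : ∀ r, 0 ≤ r → HasDerivAt ψ (-(p r * φ r)) r := fun r hr => by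
    have hd : DifferentiableAt ℝ (deriv φ) r :=
      (hφ.deriv' (n := 1)).differentiable (by norm_num) r
    refine ((dH r).neg.exp.mul hd.hasDerivAt).congr_deriv ?_
    have := hODE r hr
    simp only [p, max_eq_right hr, Pi.neg_apply]
    linear_combination Real.exp (-Hc r) * this
  have hE : ∀ r, 0 ≤ r → 0 < Real.exp (Hc r) := fun r _ => Real.exp_pos _
  have hp : ∀ r, 0 ≤ r → 0 ≤ p r := fun r _ =>
    mul_nonneg (Real.exp_pos _).le (hq_nonneg _ (le_max_left _ _))
  have hsc0 : sc 0 = 0 := intervalIntegral.integral_same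
  have hψ0 : ψ 0 = 1 := by simp [ψ, Hc, hφ'0]
  have hsc_mono : StrictMono sc := strictMono_of_hasDerivAt_pos ds fun r => Real.exp_pos _
  have hsc_pos : ∀ r, 0 < r → 0 < sc r := fun r hr => hsc0 ▸ hsc_mono hr
  have hPI : ∀ r, 0 ≤ r → P r ≤ I := fun r hr => by
    have heq : P r = ∫ x in Ioc 0 r, s x * Real.exp (-H x) * q x := by
      rw [← intervalIntegral.integral_of_le hr]
      refine intervalIntegral.integral_congr fun x hx => ?_
      rw [uIcc_of_le hr] at hx
      simp only [p, hsc x hx.1, hHc x hx.1, max_eq_right hx.1]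
      ring
    rw [heq]
    refine setIntegral_mono_set hint ?_ Ioc_subset_Ioi_self.eventuallyLE
    filter_upwards [ae_restrict_mem measurableSet_Ioi] with x hx
    have hx0 : 0 < x := hx
    exact mul_nonneg (mul_nonneg (hsc x hx0.le ▸ (hsc_pos x hx0).le) (Real.exp_pos _).le)
      (hq_nonneg x hx0.le)
  have key : ∀ r, 0 ≤ r → 0 ≤ φ r ∧ φ r ≤ sc r ∧ 1 - I ≤ ψ r := fun r hr =>
    bounds_of_lt_one hE hp (fun r _ => ds r) (fun r _ => dφ r) dψ (fun r _ => dP r) hsc0 hφ0 hψ0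
      intervalIntegral.integral_same hPI hlt hr
  have hφ_ge : ∀ r, 0 ≤ r → (1 - I) * sc r ≤ φ r := fun r hr => by
    have := le_of_hasDerivAt_nonneg hr (fun x _ => (dφ x).sub ((ds x).const_mul (1 - I)))
      (fun x hx => by nlinarith [hE x hx.1.le, (key x hx.1.le).2.2])
    simp only [Pi.sub_apply, hsc0, hφ0] at this
    linarith
  refine ⟨fun r hr => hsc r hr ▸ (key r hr).2.1, ?_⟩
  have hanti := antitoneOn_div_of_slope hE hp (fun r _ => ds r) (fun r _ => dφ r) dψ hsc0 hφ0
    (fun r hr => (key r hr).1) hsc_pos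
  have hright : ∀ σ, 0 ≤ σ → sc (rf σ) = σ := fun σ hσ =>
    (hsc _ (hrf_nonneg σ hσ)).trans (hrf_right σ hσ)
  have hrf_pos : ∀ σ, 0 < σ → 0 < rf σ := fun σ hσ =>
    hsc_mono.lt_iff_lt.1 (by rwa [hsc0, hright σ hσ.le])
  have hone : ∀ σ ∈ Ici (1 : ℝ), 0 < σ := fun σ hσ => one_pos.trans_le hσ
  obtain ⟨L, hL, hIL⟩ := exists_tendsto_atTop_of_antitoneOn (f := fun σ => φ (rf σ) / σ)
    (a := 1) (c := 1 - I)
    (fun σ hσ τ hτ hle => by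
      have h := hanti (hrf_pos σ (hone σ hσ)) (hrf_pos τ (hone τ hτ))
        (hsc_mono.le_iff_le.1 (by rwa [hright σ (hone σ hσ).le, hright τ (hone τ hτ).le]))
      simpa only [hright σ (hone σ hσ).le, hright τ (hone τ hτ).le] using h)
    (fun σ hσ => by
      rw [le_div_iff₀ (hone σ hσ)]
      have h := hφ_ge _ (hrf_nonneg σ (hone σ hσ).le)
      rwa [hright σ (hone σ hσ).le] at h)
  exact ⟨L, hL, hIL, sub_pos.2 hlt⟩
end

section
/- Let q : [0,∞) → ℝ be continuous with q ≥ 0 and q(r) = O(r^{−4}) as r → ∞, and let κ : [0,∞) → ℝ be continuous such that ∫₀^r κ(ρ) dρ = β₀ + β₁ r^{−2} + o(r^{−2}) as r → ∞ for some constants β₀, β₁ ∈ ℝ. Let φ : [0,∞) → ℝ be twice continuously differentiable with φ'' − κφ' + qφ = 0, φ(0) = 0, φ'(0) = 1, and φ(r) > 0 for all r > 0. Then there exist constants φ₋₁ ≥ 0 and φ₀ ∈ ℝ such that φ'(r) = φ₋₁ + O(r^{−2}) and φ(r) = φ₋₁ r + φ₀ + O(r^{−1}) as r → ∞. -/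
open MeasureTheory Set Filter Asymptotics

/-- A function whose derivative is bounded by `C / r ^ (k + 2)` converges at infinity, with rate
`C / (k + 1) / r ^ (k + 1)`. -/
theorem exists_abs_sub_le_of_deriv_decay {f f' : ℝ → ℝ} {R C : ℝ} (hR : 0 < R) (k : ℕ)
    (hf : ∀ r, R ≤ r → HasDerivAt f (f' r) r)
    (hb : ∀ r, R ≤ r → |f' r| ≤ C / r ^ (k + 2)) :
    ∃ L : ℝ, ∀ r, R ≤ r → |f r - L| ≤ C / (k + 1) * (r ^ (k + 1))⁻¹ := by
  have hC : 0 ≤ C := by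
    have h := (abs_nonneg _).trans (hb R le_rfl)
    rwa [le_div_iff₀ (by positivity), zero_mul] at h
  have hd : ∀ r, R ≤ r →
      HasDerivAt (fun r : ℝ => C / (k + 1) * (r ^ (k + 1))⁻¹) (-(C / r ^ (k + 2))) r := by
    intro r hr
    have hr0 : 0 < r := hR.trans_le hr
    have h := ((hasDerivAt_pow (k + 1) r).inv (by positivity)).const_mul (C / ((k : ℝ) + 1))
    refine h.congr_deriv ?_
    have : (k : ℝ) + 1 ≠ 0 := by positivity
    push_cast
    field_simp
    ring
  have hmono : MonotoneOn (fun r => f r - C / (k + 1) * (r ^ (k + 1))⁻¹) (Ici R) := by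
    refine monotoneOn_of_hasDerivWithinAt_nonneg (f' := fun r => f' r - -(C / r ^ (k + 2)))
      (convex_Ici R)
      (fun r hr => ((hf r hr).sub (hd r hr)).continuousAt.continuousWithinAt) ?_ ?_
    · intro r hr
      rw [interior_Ici] at hr
      exact ((hf r hr.le).sub (hd r hr.le)).hasDerivWithinAt
    · intro r hr
      rw [interior_Ici] at hr
      linarith [neg_le_of_abs_le (hb r hr.le)]
  have hanti : AntitoneOn (fun r => f r + C / (k + 1) * (r ^ (k + 1))⁻¹) (Ici R) := by
    refine antitoneOn_of_hasDerivWithinAt_nonpos (f' := fun r => f' r + -(C / r ^ (k + 2)))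
      (convex_Ici R)
      (fun r hr => ((hf r hr).add (hd r hr)).continuousAt.continuousWithinAt) ?_ ?_
    · intro r hr
      rw [interior_Ici] at hr
      exact ((hf r hr.le).add (hd r hr.le)).hasDerivWithinAt
    · intro r hr
      rw [interior_Ici] at hr
      linarith [le_of_abs_le (hb r hr.le)]
  have hle : ∀ r s, R ≤ r → R ≤ s →
      f s - C / (k + 1) * (s ^ (k + 1))⁻¹ ≤ f r + C / (k + 1) * (r ^ (k + 1))⁻¹ := by
    intro r s hr hs
    have hm : R ≤ max r s := hr.trans (le_max_left _ _)
    have h1 := hmono hs hm (le_max_right r s)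
    have h2 := hanti hr hm (le_max_left r s)
    have h3 : 0 ≤ C / (k + 1) * ((max r s) ^ (k + 1))⁻¹ := by
      have := hR.trans_le hm
      positivity
    dsimp only at h1 h2
    linarith
  refine ⟨sSup ((fun r => f r - C / (k + 1) * (r ^ (k + 1))⁻¹) '' Ici R), fun r hr => ?_⟩
  have hlow := le_csSup (s := (fun r => f r - C / (k + 1) * (r ^ (k + 1))⁻¹) '' Ici R)
    ⟨_, by rintro _ ⟨s, hs, rfl⟩; exact hle R s le_rfl hs⟩ (mem_image_of_mem _ hr)
  have hup := csSup_le (s := (fun r => f r - C / (k + 1) * (r ^ (k + 1))⁻¹) '' Ici R)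
    (nonempty_Ici.image _) (by rintro _ ⟨s, hs, rfl⟩; exact hle r s hr hs)
  rw [abs_le]
  constructor <;> linarith

/-- The primitive of a function continuous on `[0, ∞)` is differentiable on `(0, ∞)`. -/
theorem hasDerivAt_integral_of_continuousOn_Ici {κ : ℝ → ℝ} (hκ : ContinuousOn κ (Ici 0)) {r : ℝ}
    (hr : 0 < r) : HasDerivAt (fun r => ∫ ρ in (0 : ℝ)..r, κ ρ) (κ r) r := by
  refine intervalIntegral.integral_hasDerivAt_right ?_ ?_ (hκ.continuousAt (Ici_mem_nhds hr))
  · refine (hκ.mono ?_).intervalIntegrable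
    rw [uIcc_of_le hr.le]
    exact Icc_subset_Ici_self
  · exact (hκ.mono Ioi_subset_Ici_self).stronglyMeasurableAtFilter isOpen_Ioi r hr

/-- Mean value bound for a function whose derivative is at most `K` on `[s, ∞)`. -/
theorem le_add_mul_sub_of_deriv_le {φ : ℝ → ℝ} (hφ : Differentiable ℝ φ) {s K : ℝ}
    (h : ∀ r, s ≤ r → deriv φ r ≤ K) {r : ℝ} (hr : s ≤ r) : φ r ≤ φ s + K * (r - s) := by
  have := (convex_Ici s).image_sub_le_mul_sub_of_deriv_le hφ.continuous.continuousOn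
    hφ.differentiableOn (fun x hx => h x (interior_subset hx)) s self_mem_Ici r hr hr
  linarith

/-- If `q ≥ 0` with `q = O(r^{-4})` and `∫₀^r κ = β₀ + β₁ r^{-2} + o(r^{-2})`,
then a globally positive solution of `φ'' - κ φ' + q φ = 0`, `φ(0) = 0`,
`φ'(0) = 1` admits the expansion `φ'(r) = a + O(r^{-2})`,
`φ(r) = a r + b + O(r^{-1})` with `a ≥ 0` (here `a = φ₋₁`, `b = φ₀`). -/
theorem stmt_10 (q κ φ : ℝ → ℝ) (β₀ β₁ : ℝ)
    (hq_cont : ContinuousOn q (Ici 0))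
    (hq_nonneg : ∀ r, 0 ≤ r → 0 ≤ q r)
    (hq_O : q =O[atTop] fun r => 1 / r ^ 4)
    (hκ : ContinuousOn κ (Ici 0))
    (H : ℝ → ℝ) (hH : ∀ r, H r = ∫ ρ in (0:ℝ)..r, κ ρ)
    (hH_asympt : (fun r => H r - β₀ - β₁ / r ^ 2) =o[atTop] fun r => 1 / r ^ 2)
    (hφ : ContDiff ℝ 2 φ)
    (hODE : ∀ r, 0 ≤ r → deriv (deriv φ) r - κ r * deriv φ r + q r * φ r = 0)
    (hφ0 : φ 0 = 0) (hφ'0 : deriv φ 0 = 1)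
    (hφpos : ∀ r, 0 < r → 0 < φ r) :
    ∃ a b : ℝ, 0 ≤ a ∧
      ((fun r => deriv φ r - a) =O[atTop] fun r => 1 / r ^ 2) ∧
      ((fun r => φ r - (a * r + b)) =O[atTop] fun r => 1 / r) := by
  have hφd : Differentiable ℝ φ := hφ.differentiable (by norm_num)
  have hφdd : Differentiable ℝ (deriv φ) :=
    (contDiff_succ_iff_deriv.1 (show ContDiff ℝ (1 + 1) φ by
      rwa [one_add_one_eq_two])).2.2.differentiable (by norm_num)
  have hHd : ∀ r, 0 < r → HasDerivAt H (κ r) r := fun r hr => by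
    rw [funext hH]
    exact hasDerivAt_integral_of_continuousOn_Ici hκ hr
  have hHO : (fun r => H r - β₀) =O[atTop] fun r : ℝ => 1 / r ^ 2 := by
    have h : (fun r : ℝ => β₁ * (1 / r ^ 2)) =O[atTop] fun r : ℝ => 1 / r ^ 2 :=
      (isBigO_refl _ _).const_mul_left β₁
    exact (hH_asympt.isBigO.add h).congr_left fun r => by ring
  have hdecay : Tendsto (fun r : ℝ => 1 / r ^ 2) atTop (nhds 0) := by
    simpa only [one_div] using! (tendsto_pow_atTop (α := ℝ) two_ne_zero).inv_tendsto_atTop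
  have hHlim : Tendsto H atTop (nhds β₀) :=
    tendsto_sub_nhds_zero_iff.1 (hHO.trans_tendsto hdecay)
  have hexpO : (fun r => Real.exp (H r) - Real.exp β₀) =O[atTop] fun r : ℝ => 1 / r ^ 2 :=
    (((Real.hasDerivAt_exp β₀).isBigO_sub).comp_tendsto hHlim).trans hHO
  let ψ : ℝ → ℝ := fun r => Real.exp (-H r) * deriv φ r
  have hψφ : ∀ r, deriv φ r = Real.exp (H r) * ψ r := fun r => by
    simp only [ψ, ← mul_assoc, ← Real.exp_add, add_neg_cancel, Real.exp_zero, one_mul]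
  have hψd : ∀ r, 0 < r → HasDerivAt ψ (-(Real.exp (-H r) * (q r * φ r))) r := fun r hr => by
    refine ((hHd r hr).neg.exp.mul (hφdd r).hasDerivAt).congr_deriv ?_
    linear_combination Real.exp (-H r) * hODE r hr.le
  have hψanti : AntitoneOn ψ (Ioi 0) := by
    refine antitoneOn_of_hasDerivWithinAt_nonpos (convex_Ioi 0)
      (f' := fun r => -(Real.exp (-H r) * (q r * φ r)))
      (fun r hr => (hψd r hr).continuousAt.continuousWithinAt) ?_ ?_
    · intro r hr
      exact (hψd r (interior_subset hr)).hasDerivWithinAt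
    · intro r hr
      have hr0 : 0 < r := interior_subset hr
      have h1 := hq_nonneg r hr0.le
      have h2 := hφpos r hr0
      exact neg_nonpos.2 (by positivity)
  obtain ⟨C, hCpos, hC⟩ := hq_O.exists_pos
  obtain ⟨R, hR⟩ := eventually_atTop.1 ((eventually_ge_atTop (1 : ℝ)).and (hC.bound.and
    (hHlim.eventually (Icc_mem_nhds (sub_one_lt β₀) (lt_add_one β₀)))))
  have hR1 : 1 ≤ R := (hR R le_rfl).1
  have hR0 : 0 < R := by linarith
  have hφ'le : ∀ r, R ≤ r → deriv φ r ≤ Real.exp (β₀ + 1) * |ψ R| := fun r hr => by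
    rw [hψφ]
    have h1 : ψ r ≤ |ψ R| := (hψanti hR0 (hR0.trans_le hr) hr).trans (le_abs_self _)
    have h2 : Real.exp (H r) ≤ Real.exp (β₀ + 1) := Real.exp_le_exp.2 (hR r hr).2.2.2
    exact (mul_le_mul_of_nonneg_left h1 (Real.exp_pos _).le).trans
      (mul_le_mul_of_nonneg_right h2 (abs_nonneg _))
  have hφle : ∀ r, R ≤ r → φ r ≤ (φ R + Real.exp (β₀ + 1) * |ψ R|) * r := fun r hr => by
    have h := le_add_mul_sub_of_deriv_le hφd hφ'le hr
    have h1 := hφpos R hR0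
    have h2 : 0 ≤ Real.exp (β₀ + 1) * |ψ R| := by positivity
    nlinarith
  have hψnonneg : ∀ r, R ≤ r → 0 ≤ ψ r := by
    intro s hs
    by_contra! hneg
    have hs0 : 0 < s := hR0.trans_le hs
    have hφ'neg : ∀ r, s ≤ r → deriv φ r ≤ Real.exp (β₀ - 1) * ψ s := fun r hr => by
      rw [hψφ]
      have h1 : ψ r ≤ ψ s := hψanti hs0 (hs0.trans_le hr) hr
      have h2 : Real.exp (β₀ - 1) ≤ Real.exp (H r) :=
        Real.exp_le_exp.2 (hR r (hs.trans hr)).2.2.1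
      exact (mul_le_mul_of_nonneg_left h1 (Real.exp_pos _).le).trans
        (mul_le_mul_of_nonpos_right h2 hneg.le)
    set c := Real.exp (β₀ - 1) * ψ s with hc
    have hcneg : c < 0 := mul_neg_of_pos_of_neg (Real.exp_pos _) hneg
    have hφs := hφpos s hs0
    have hle : s ≤ s + φ s / -c := by
      have : 0 < φ s / -c := div_pos hφs (by linarith)
      linarith
    have h := le_add_mul_sub_of_deriv_le hφd hφ'neg hle
    have h' : c * (s + φ s / -c - s) = -φ s := by
      have := hcneg.ne
      field_simp
      ring
    have := hφpos _ (hs0.trans_le hle)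
    linarith
  set K := φ R + Real.exp (β₀ + 1) * |ψ R|
  obtain ⟨L, hL⟩ := exists_abs_sub_le_of_deriv_decay (C := Real.exp (1 - β₀) * (C * K)) hR0 1
    (fun r hr => hψd r (hR0.trans_le hr)) (fun r hr => by
      have hr0 : 0 < r := hR0.trans_le hr
      have h1 : q r ≤ C / r ^ 4 := by
        have h := (hR r hr).2.1
        rw [Real.norm_eq_abs, Real.norm_of_nonneg (by positivity), mul_one_div] at h
        exact (le_abs_self _).trans h
      have h2 : Real.exp (-H r) ≤ Real.exp (1 - β₀) :=
        Real.exp_le_exp.2 (by linarith [(hR r hr).2.2.1])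
      have h3 := hφpos r hr0
      have h4 := hq_nonneg r hr0.le
      rw [abs_neg, abs_of_nonneg (by positivity)]
      calc Real.exp (-H r) * (q r * φ r)
          ≤ Real.exp (1 - β₀) * (C / r ^ 4 * (K * r)) := by
            gcongr
            exact hφle r hr
        _ = Real.exp (1 - β₀) * (C * K) / r ^ (1 + 2) := by
            field_simp
            ring)
  have hψO : (fun r => ψ r - L) =O[atTop] fun r : ℝ => 1 / r ^ 2 := by
    refine IsBigO.of_bound (Real.exp (1 - β₀) * (C * K) / ((1 : ℕ) + 1))
      ((eventually_ge_atTop R).mono fun r hr => ?_)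
    rw [Real.norm_eq_abs, Real.norm_of_nonneg (by positivity), one_div]
    exact hL r hr
  have hL0 : 0 ≤ L := ge_of_tendsto (tendsto_sub_nhds_zero_iff.1 (hψO.trans_tendsto hdecay))
    ((eventually_ge_atTop R).mono hψnonneg)
  have hφ'O : (fun r => deriv φ r - Real.exp β₀ * L) =O[atTop] fun r : ℝ => 1 / r ^ 2 := by
    have hexp1 : (fun r => Real.exp (H r)) =O[atTop] fun _ => (1 : ℝ) :=
      ((Real.continuous_exp.tendsto β₀).comp hHlim).isBigO_one ℝ
    have h := (hexp1.mul hψO).add (hexpO.const_mul_left L |>.congr_right fun r =>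
      (one_mul (1 / r ^ 2)).symm)
    refine h.congr (fun r => ?_) fun r => one_mul _
    rw [hψφ r]
    ring
  obtain ⟨D, -, hD⟩ := hφ'O.exists_pos
  obtain ⟨S, hS⟩ := eventually_atTop.1 ((eventually_ge_atTop (1 : ℝ)).and hD.bound)
  have hS0 : 0 < S := by linarith [(hS S le_rfl).1]
  obtain ⟨b, hb⟩ := exists_abs_sub_le_of_deriv_decay (C := D)
    (f := fun r => φ r - Real.exp β₀ * L * r) (f' := fun r => deriv φ r - Real.exp β₀ * L) hS0 0
    (fun r _ => ((hφd r).hasDerivAt.sub ((hasDerivAt_id r).const_mul _)).congr_deriv (by simp))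
    (fun r hr => by
      have h := (hS r hr).2
      rwa [Real.norm_eq_abs, Real.norm_of_nonneg (by positivity), mul_one_div] at h)
  refine ⟨Real.exp β₀ * L, b, by positivity, hφ'O,
    IsBigO.of_bound D ((eventually_ge_atTop S).mono fun r hr => ?_)⟩
  have hr0 : 0 < r := hS0.trans_le hr
  rw [Real.norm_eq_abs, Real.norm_of_nonneg (by positivity), one_div, ← sub_sub]
  simpa using hb r hr
end

section
/- Let F : (0,∞) → ℝ be continuous with r² F(r) bounded near r = 0, and let τ : (0,∞) → ℝ be continuously differentiable with τ' + τ²/2 + F = 0 on (0,∞) and τ(r) = 2/r + O(r) as r → 0⁺. Define Ψ(r) := r² exp(∫₀^r (τ(ρ)/2 − 1/ρ) dρ). Then: (i) for all r > 0, τ(r) − 2/r = −Ψ(r)⁻¹ ∫₀^r F(ρ) Ψ(ρ) dρ; (ii) if the limit τ₂ := −lim_{r→∞} r² Ψ(r)⁻¹ ∫₀^r F(ρ)Ψ(ρ) dρ exists in ℝ, then τ(r) = 2/r + τ₂ r^{−2} + o(r^{−2}) as r → ∞. -/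
open MeasureTheory Set Filter Topology Asymptotics

/-- A function continuous on `(0, ∞)` and bounded near `0` is integrable on `(0, r)`. -/
theorem intervalIntegrable_of_continuousOn_Ioi_of_bounded {f : ℝ → ℝ}
    (hf : ContinuousOn f (Ioi 0)) {C ε : ℝ} (hε : 0 < ε)
    (hb : ∀ x, 0 < x → x < ε → |f x| ≤ C) {r : ℝ} (hr : 0 < r) :
    IntervalIntegrable f volume 0 r := by
  have hδ : 0 < min (ε / 2) r := by positivity
  have hδε : min (ε / 2) r < ε := (min_le_left _ _).trans_lt (by linarith)
  have hnear : IntervalIntegrable f volume 0 (min (ε / 2) r) := by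
    rw [intervalIntegrable_iff_integrableOn_Ioc_of_le hδ.le]
    refine IntegrableOn.of_bound (by simp)
      ((hf.mono fun x hx => hx.1).aestronglyMeasurable measurableSet_Ioc) C ?_
    filter_upwards [ae_restrict_mem measurableSet_Ioc] with x hx
    exact hb x hx.1 (hx.2.trans_lt hδε)
  refine hnear.trans (ContinuousOn.intervalIntegrable_of_Icc (min_le_right _ _) ?_)
  exact hf.mono fun x hx => hδ.trans_le hx.1

/-- Key lemma for the no-go theorem (`n = 3`): for a solution of
`τ' + τ²/2 + F = 0` with `τ(r) = 2/r + O(r)` at the vertex, setting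
`Ψ(r) = r² exp(∫₀^r (τ/2 - 1/ρ))`, one has
`τ - 2/r = -Ψ⁻¹ ∫₀^r F Ψ`, and if
`τ₂ := -lim r² Ψ⁻¹ ∫₀^r F Ψ` exists then `τ = 2/r + τ₂ r^{-2} + o(r^{-2})`. -/
theorem stmt_11 (F τ Ψ : ℝ → ℝ)
    (hF_cont : ContinuousOn F (Ioi 0))
    (hF_bdd : ∃ C ε : ℝ, 0 < C ∧ 0 < ε ∧ ∀ r, 0 < r → r < ε → |r ^ 2 * F r| ≤ C)
    (hτ : ∀ r, 0 < r → HasDerivAt τ (-(τ r ^ 2 / 2) - F r) r)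
    (hτ0 : (fun r => τ r - 2 / r) =O[𝓝[>] 0] fun r => r)
    (hΨ : ∀ r, Ψ r = r ^ 2 * Real.exp (∫ ρ in (0:ℝ)..r, (τ ρ / 2 - 1 / ρ))) :
    (∀ r, 0 < r → τ r - 2 / r = -(Ψ r)⁻¹ * ∫ ρ in (0:ℝ)..r, F ρ * Ψ ρ) ∧
    ∀ τ₂ : ℝ,
      Tendsto (fun r => -(r ^ 2 * (Ψ r)⁻¹ * ∫ ρ in (0:ℝ)..r, F ρ * Ψ ρ))
        atTop (𝓝 τ₂) →
      Tendsto (fun r => r ^ 2 * (τ r - 2 / r)) atTop (𝓝 τ₂) := by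
  have hτc : ContinuousOn τ (Ioi 0) := fun x hx => (hτ x hx).continuousAt.continuousWithinAt
  have hinv : ContinuousOn (fun r : ℝ => 1 / r) (Ioi 0) :=
    continuousOn_const.div continuousOn_id fun x hx => ne_of_gt hx
  have hhc : ContinuousOn (fun ρ => τ ρ / 2 - 1 / ρ) (Ioi 0) := (hτc.div_const 2).sub hinv
  have hh_int : ∀ r, 0 < r → IntervalIntegrable (fun ρ => τ ρ / 2 - 1 / ρ) volume 0 r := by
    obtain ⟨C, hC, hCb⟩ := hτ0.exists_pos
    obtain ⟨ε, hε, hεb⟩ := mem_nhdsGT_iff_exists_Ioo_subset.1 hCb.bound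
    intro r hr
    refine intervalIntegrable_of_continuousOn_Ioi_of_bounded hhc (C := C * ε / 2) hε ?_ hr
    intro x hx hxε
    have h := hεb ⟨hx, hxε⟩
    simp only [mem_ofPred_eq, Real.norm_eq_abs, abs_of_pos hx] at h
    have heq : τ x / 2 - 1 / x = (τ x - 2 / x) / 2 := by ring
    rw [heq, abs_div, abs_two]
    have := mul_le_mul_of_nonneg_left hxε.le hC.le
    linarith
  set J : ℝ → ℝ := fun r => ∫ ρ in (0:ℝ)..r, (τ ρ / 2 - 1 / ρ)
  have hJd : ∀ r, 0 < r → HasDerivAt J (τ r / 2 - 1 / r) r := fun r hr =>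
    intervalIntegral.integral_hasDerivAt_right (hh_int r hr)
      (hhc.stronglyMeasurableAtFilter isOpen_Ioi r hr) (hhc.continuousAt (Ioi_mem_nhds hr))
  have hJc : ∀ r, 0 < r → ContinuousOn J (Icc 0 r) := fun r hr => by
    have h := intervalIntegral.continuousOn_primitive_interval ((intervalIntegrable_iff').1 (hh_int r hr))
    rwa [uIcc_of_le hr.le] at h
  have hΨJ : Ψ = fun r => r ^ 2 * Real.exp (J r) := funext hΨ
  have hΨpos : ∀ r, 0 < r → 0 < Ψ r := fun r hr => by rw [hΨ]; positivity
  have hΨd : ∀ r, 0 < r → HasDerivAt Ψ ((1 / r + τ r / 2) * Ψ r) r := fun r hr => by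
    rw [hΨJ]
    refine ((hasDerivAt_pow 2 r).mul (hJd r hr).exp).congr_deriv ?_
    field_simp
    ring
  have hsrc : ∀ r, 0 < r → IntervalIntegrable (fun ρ => F ρ * Ψ ρ) volume 0 r := by
    obtain ⟨C, ε, -, hε, hb⟩ := hF_bdd
    intro r hr
    have h := intervalIntegrable_of_continuousOn_Ioi_of_bounded
      ((continuousOn_id.pow 2).mul hF_cont) hε hb hr
    have hexp : ContinuousOn (fun ρ => Real.exp (J ρ)) (uIcc 0 r) := by
      rw [uIcc_of_le hr.le]
      exact (hJc r hr).rexp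
    convert h.mul_continuousOn hexp using 2 with ρ
    simp only [hΨJ, id, Pi.mul_apply, Pi.pow_apply]
    ring
  have hgd : ∀ r, 0 < r →
      HasDerivAt (fun r => (τ r - 2 / r) * Ψ r) (-(F r * Ψ r)) r := fun r hr => by
    have hd := (hasDerivAt_const r (2 : ℝ)).div (hasDerivAt_id r) hr.ne'
    refine (((hτ r hr).sub hd).mul (hΨd r hr)).congr_deriv ?_
    simp only [id, Pi.div_apply, Pi.sub_apply]
    field_simp
    ring
  have hvertex : Tendsto (fun r => r ^ 2 * (τ r - 2 / r)) (𝓝[>] 0) (𝓝 0) := by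
    refine ((isBigO_refl (fun r : ℝ => r ^ 2) (𝓝[>] 0)).mul hτ0).trans_tendsto ?_
    have h : Continuous fun r : ℝ => r ^ 2 * r := by fun_prop
    simpa using (h.tendsto 0).mono_left nhdsWithin_le_nhds
  have hgc : ∀ r, 0 < r → ContinuousOn (fun r => (τ r - 2 / r) * Ψ r) (Icc 0 r) := by
    intro r hr x hx
    rcases hx.1.eq_or_lt with rfl | hx0
    · have hk : ContinuousWithinAt (fun r => r ^ 2 * (τ r - 2 / r)) (Ici 0) 0 := by
        rw [← Ioi_insert, continuousWithinAt_insert_self]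
        simpa [ContinuousWithinAt] using hvertex
      refine ((hk.mono Icc_subset_Ici_self).mul (hJc r hr 0 hx).rexp).congr_of_eventuallyEq
        (.of_forall fun y => ?_) ?_ <;> simp only [hΨJ, Pi.mul_apply] <;> ring
    · exact (hgd x hx0).continuousAt.continuousWithinAt
  have main : ∀ r, 0 < r → τ r - 2 / r = -(Ψ r)⁻¹ * ∫ ρ in (0:ℝ)..r, F ρ * Ψ ρ := by
    intro r hr
    have h := intervalIntegral.integral_eq_sub_of_hasDerivAt_of_le hr.le (hgc r hr)
      (fun x hx => hgd x hx.1) (hsrc r hr).neg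
    have h0 : Ψ 0 = 0 := by simp [hΨ]
    rw [intervalIntegral.integral_neg, h0, mul_zero, sub_zero] at h
    rw [neg_mul, ← mul_neg, h]
    field_simp [(hΨpos r hr).ne']
  refine ⟨main, fun τ₂ hlim => hlim.congr' ?_⟩
  filter_upwards [eventually_gt_atTop 0] with r hr
  rw [main r hr]
  ring
end

section
/- Let q : [0,∞) → ℝ be continuous with q ≥ 0, suppose the improper integral ∫₀^∞ ρ q(ρ) dρ converges with ∫₀^∞ ρ q(ρ) dρ < 1, and let φ : [0,∞) → ℝ be twice continuously differentiable with φ'' + qφ = 0, φ(0) = 0 and φ'(0) = 1. Then the function r ↦ φ(r) − r φ'(r) is nondecreasing, its limit φ₀ := lim_{r→∞} (φ(r) − r φ'(r)) exists in [0, ∞] and equals ∫₀^∞ ρ q(ρ) φ(ρ) dρ; moreover φ₀ = 0 if and only if q vanishes identically, and in that case φ(r) = r for all r ≥ 0. -/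
open MeasureTheory Set

/-- A continuous real function that is positive at `0` and vanishes or is negative somewhere on
`[0,∞)` has a first zero. -/
lemma exists_first_zero {f : ℝ → ℝ} (hf : Continuous f) (h0 : 0 < f 0) {r : ℝ} (hr : 0 ≤ r)
    (hfr : f r ≤ 0) : ∃ s, 0 ≤ s ∧ f s = 0 ∧ ∀ t ∈ Icc 0 s, 0 ≤ f t := by
  have hne : (Icc 0 r ∩ f ⁻¹' Iic 0).Nonempty := ⟨r, ⟨hr, le_rfl⟩, hfr⟩
  have hcomp : IsCompact (Icc 0 r ∩ f ⁻¹' Iic 0) :=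
    isCompact_Icc.inter_right (isClosed_Iic.preimage hf)
  obtain ⟨s, ⟨⟨hs0, hsr⟩, hfs⟩, hmin⟩ := hcomp.exists_isLeast hne
  have hpos : ∀ t, 0 ≤ t → t < s → 0 < f t := by
    intro t ht hts
    by_contra! h
    exact absurd (hmin ⟨⟨ht, hts.le.trans hsr⟩, h⟩) (not_le.mpr hts)
  have hs : f s = 0 := by
    obtain ⟨t, ht, hft⟩ := intermediate_value_Icc' hs0 hf.continuousOn ⟨hfs, h0.le⟩
    rcases ht.2.lt_or_eq with h | h
    · exact absurd hft (hpos t ht.1 h).ne'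
    · rwa [← h]
  refine ⟨s, hs0, hs, fun t ht => ?_⟩
  rcases ht.2.lt_or_eq with h | h
  · exact (hpos t ht.1 h).le
  · rw [h, hs]

section Oscillation

variable {q φ : ℝ → ℝ}

lemma hasDerivAt_of_contDiff_two (hφ : ContDiff ℝ 2 φ) (r : ℝ) :
    HasDerivAt φ (deriv φ r) r :=
  ((hφ.differentiable (by norm_num)) r).hasDerivAt

lemma contDiff_one_deriv (hφ : ContDiff ℝ 2 φ) : ContDiff ℝ 1 (deriv φ) :=
  hφ.deriv' (n := 1)

lemma hasDerivAt_deriv_of_contDiff_two (hφ : ContDiff ℝ 2 φ) (r : ℝ) :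
    HasDerivAt (deriv φ) (deriv (deriv φ) r) r :=
  (((contDiff_one_deriv hφ).differentiable (by norm_num)) r).hasDerivAt

lemma continuous_deriv_deriv (hφ : ContDiff ℝ 2 φ) : Continuous (deriv (deriv φ)) :=
  (contDiff_one_deriv hφ).continuous_deriv le_rfl

lemma integral_deriv_deriv (hφ : ContDiff ℝ 2 φ) (hφ'0 : deriv φ 0 = 1) (r : ℝ) :
    ∫ x in (0 : ℝ)..r, deriv (deriv φ) x = deriv φ r - 1 := by
  rw [intervalIntegral.integral_eq_sub_of_hasDerivAt
    (fun x _ => hasDerivAt_deriv_of_contDiff_two hφ x)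
    ((continuous_deriv_deriv hφ).intervalIntegrable _ _), hφ'0]

/-- Under the smallness condition `∫ ρ q < 1`, the solution has positive derivative. -/
lemma deriv_pos_of_integral_lt_one (hq_nonneg : ∀ r, 0 ≤ r → 0 ≤ q r)
    (hint : IntegrableOn (fun ρ => ρ * q ρ) (Ioi 0))
    (hlt : (∫ ρ in Ioi (0:ℝ), ρ * q ρ) < 1) (hφ : ContDiff ℝ 2 φ)
    (hODE : ∀ r, 0 ≤ r → deriv (deriv φ) r + q r * φ r = 0)
    (hφ0 : φ 0 = 0) (hφ'0 : deriv φ 0 = 1) {r : ℝ} (hr : 0 ≤ r) : 0 < deriv φ r := by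
  by_contra! hneg
  have hc1 : Continuous (deriv φ) := (contDiff_one_deriv hφ).continuous
  obtain ⟨s, hs0, hs, hnn⟩ := exists_first_zero hc1 (by rw [hφ'0]; exact one_pos) hr hneg
  have hmono : MonotoneOn φ (Icc 0 s) :=
    monotoneOn_of_deriv_nonneg (convex_Icc 0 s) hφ.continuous.continuousOn
      (hφ.differentiable (by norm_num)).differentiableOn
      fun x hx => hnn x (interior_subset hx)
  have hφnn : ∀ x ∈ Icc 0 s, 0 ≤ φ x := fun x hx => by
    simpa [hφ0] using hmono ⟨le_rfl, hs0⟩ hx hx.1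
  have hanti : AntitoneOn (deriv φ) (Icc 0 s) :=
    antitoneOn_of_deriv_nonpos (convex_Icc 0 s) hc1.continuousOn
      ((contDiff_one_deriv hφ).differentiable (by norm_num)).differentiableOn
      fun x hx => by
        have hx := interior_subset hx
        nlinarith [hODE x hx.1, mul_nonneg (hq_nonneg x hx.1) (hφnn x hx)]
  have hle : ∀ x ∈ Icc 0 s, φ x ≤ x := by
    have h : AntitoneOn (fun x => φ x - x) (Icc 0 s) := by
      refine antitoneOn_of_hasDerivWithinAt_nonpos (f' := fun x => deriv φ x - 1)
        (convex_Icc 0 s) (hφ.continuous.sub continuous_id).continuousOn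
        (fun x _ => ((hasDerivAt_of_contDiff_two hφ x).sub (hasDerivAt_id x)).hasDerivWithinAt)
        fun x hx => ?_
      have hx := interior_subset hx
      have := hanti ⟨le_rfl, hs0⟩ hx hx.1
      simp only [hφ'0] at this
      linarith
    intro x hx
    have := h ⟨le_rfl, hs0⟩ hx hx.1
    simp only [hφ0] at this
    linarith
  have hI := integral_deriv_deriv hφ hφ'0 s
  have hints : IntegrableOn (fun ρ => ρ * q ρ) (Ioc 0 s) := hint.mono_set Ioc_subset_Ioi_self
  have h1 : ∫ x in (0 : ℝ)..s, -deriv (deriv φ) x ≤ ∫ x in (0 : ℝ)..s, x * q x := by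
    refine intervalIntegral.integral_mono_on hs0
      ((continuous_deriv_deriv hφ).neg.intervalIntegrable _ _)
      ((intervalIntegrable_iff_integrableOn_Ioc_of_le hs0).2 hints) fun x hx => ?_
    nlinarith [hODE x hx.1, mul_le_mul_of_nonneg_left (hle x hx) (hq_nonneg x hx.1)]
  have h2 : ∫ x in (0 : ℝ)..s, x * q x ≤ ∫ ρ in Ioi (0:ℝ), ρ * q ρ := by
    rw [intervalIntegral.integral_of_le hs0]
    refine setIntegral_mono_set hint ?_ (Ioc_subset_Ioi_self).eventuallyLE
    filter_upwards [ae_restrict_mem measurableSet_Ioi] with x hx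
    exact mul_nonneg (le_of_lt hx) (hq_nonneg x (le_of_lt hx))
  rw [intervalIntegral.integral_neg, hI, hs] at h1
  linarith

lemma pos_of_deriv_pos (hφ : ContDiff ℝ 2 φ) (hφ0 : φ 0 = 0)
    (hpos : ∀ r, 0 ≤ r → 0 < deriv φ r) {r : ℝ} (hr : 0 < r) : 0 < φ r := by
  have h : StrictMonoOn φ (Ici 0) :=
    strictMonoOn_of_deriv_pos (convex_Ici 0) hφ.continuous.continuousOn
      fun x hx => hpos x (interior_subset hx)
  simpa [hφ0] using h (mem_Ici.2 le_rfl) (mem_Ici.2 hr.le) hr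

lemma hasDerivAt_sub_mul_deriv (hφ : ContDiff ℝ 2 φ) (r : ℝ) :
    HasDerivAt (fun r => φ r - r * deriv φ r) (-(r * deriv (deriv φ) r)) r := by
  have h := (hasDerivAt_of_contDiff_two hφ r).fun_sub
    ((hasDerivAt_id' r).fun_mul (hasDerivAt_deriv_of_contDiff_two hφ r))
  exact h.congr_deriv (by ring)

lemma lintegral_Ioc_eq_ofReal (hφ : ContDiff ℝ 2 φ)
    (hODE : ∀ r, 0 ≤ r → deriv (deriv φ) r + q r * φ r = 0) (hφ0 : φ 0 = 0)
    (hnn : ∀ r, 0 ≤ r → 0 ≤ r * q r * φ r) {r : ℝ} (hr : 0 ≤ r) :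
    ∫⁻ ρ in Ioc 0 r, ENNReal.ofReal (ρ * q ρ * φ ρ) =
      ENNReal.ofReal (φ r - r * deriv φ r) := by
  have heq : ∀ x, 0 ≤ x → -(x * deriv (deriv φ) x) = x * q x * φ x := fun x hx => by
    linear_combination -x * hODE x hx
  have hcont : Continuous fun x => -(x * deriv (deriv φ) x) :=
    (continuous_id.mul (continuous_deriv_deriv hφ)).neg
  have hii := hcont.intervalIntegrable (μ := volume) 0 r
  have hI := intervalIntegral.integral_eq_sub_of_hasDerivAt
    (fun x _ => hasDerivAt_sub_mul_deriv hφ x) hii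
  simp only [hφ0, zero_mul, sub_zero] at hI
  rw [← hI, intervalIntegral.integral_of_le hr, ofReal_integral_eq_lintegral_ofReal
    ((intervalIntegrable_iff_integrableOn_Ioc_of_le hr).1 hii)]
  · exact setLIntegral_congr_fun measurableSet_Ioc fun x hx => by simp only [heq x hx.1.le]
  · filter_upwards [ae_restrict_mem measurableSet_Ioc] with x hx
    exact (hnn x hx.1.le).trans_eq (heq x hx.1.le).symm

lemma eq_id_of_coeff_eq_zero (hφ : ContDiff ℝ 2 φ)
    (hODE : ∀ r, 0 ≤ r → deriv (deriv φ) r + q r * φ r = 0)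
    (hφ0 : φ 0 = 0) (hφ'0 : deriv φ 0 = 1) (hq : ∀ r, 0 ≤ r → q r = 0) {r : ℝ} (hr : 0 ≤ r) :
    φ r = r := by
  have hd : ∀ x, 0 ≤ x → deriv φ x = 1 := fun x hx => by
    have h := integral_deriv_deriv hφ hφ'0 x
    rw [intervalIntegral.integral_congr (g := fun _ => 0)] at h
    · simp at h; linarith
    · intro y hy
      rw [uIcc_of_le hx] at hy
      simpa [hq y hy.1] using hODE y hy.1
  have h := intervalIntegral.integral_eq_sub_of_hasDerivAt (a := 0) (b := r)
    (fun x _ => hasDerivAt_of_contDiff_two hφ x)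
    ((contDiff_one_deriv hφ).continuous.intervalIntegrable _ _)
  rw [intervalIntegral.integral_congr (g := fun _ => 1)] at h
  · simp [hφ0] at h; exact h.symm
  · intro y hy
    rw [uIcc_of_le hr] at hy
    exact hd y hy.1

end Oscillation

/-- Analytic core of the no-go theorem: for the solution of `φ'' + q φ = 0`,
`φ(0) = 0`, `φ'(0) = 1` with `q ≥ 0` and `∫₀^∞ ρ q < 1`, the function
`φ - r φ'` is nondecreasing on `[0,∞)`, its limit `φ₀` exists in `[0,∞]` and
equals `∫₀^∞ ρ q φ`; moreover `φ₀ = 0` iff `q ≡ 0`, in which case `φ(r) = r`. -/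
theorem stmt_12 (q φ : ℝ → ℝ)
    (hq_cont : ContinuousOn q (Ici 0))
    (hq_nonneg : ∀ r, 0 ≤ r → 0 ≤ q r)
    (hint : IntegrableOn (fun ρ => ρ * q ρ) (Ioi 0))
    (hlt : (∫ ρ in Ioi (0:ℝ), ρ * q ρ) < 1)
    (hφ : ContDiff ℝ 2 φ)
    (hODE : ∀ r, 0 ≤ r → deriv (deriv φ) r + q r * φ r = 0)
    (hφ0 : φ 0 = 0) (hφ'0 : deriv φ 0 = 1) :
    MonotoneOn (fun r => φ r - r * deriv φ r) (Ici 0) ∧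
    Filter.Tendsto (fun r => ENNReal.ofReal (φ r - r * deriv φ r)) Filter.atTop
      (nhds (∫⁻ ρ in Ioi (0:ℝ), ENNReal.ofReal (ρ * q ρ * φ ρ))) ∧
    ((∫⁻ ρ in Ioi (0:ℝ), ENNReal.ofReal (ρ * q ρ * φ ρ)) = 0 ↔
      ∀ r, 0 ≤ r → q r = 0) ∧
    ((∫⁻ ρ in Ioi (0:ℝ), ENNReal.ofReal (ρ * q ρ * φ ρ)) = 0 →
      ∀ r, 0 ≤ r → φ r = r) := by
  have hpos : ∀ r, 0 < r → 0 < φ r := fun r hr =>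
    pos_of_deriv_pos hφ hφ0
      (fun s hs => deriv_pos_of_integral_lt_one hq_nonneg hint hlt hφ hODE hφ0 hφ'0 hs) hr
  have hnn : ∀ r, 0 ≤ r → 0 ≤ r * q r * φ r := fun r hr => by
    rcases hr.eq_or_lt with rfl | h
    · simp
    · exact mul_nonneg (mul_nonneg hr (hq_nonneg r hr)) (hpos r h).le
  have hmeas : AEMeasurable (fun ρ => ENNReal.ofReal (ρ * q ρ * φ ρ))
      (volume.restrict (Ioi 0)) := by
    refine (ContinuousOn.aemeasurable ?_ measurableSet_Ioi).ennreal_ofReal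
    exact (continuousOn_id.mul (hq_cont.mono Ioi_subset_Ici_self)).mul hφ.continuous.continuousOn
  have hmono : MonotoneOn (fun r => φ r - r * deriv φ r) (Ici 0) := by
    refine monotoneOn_of_hasDerivWithinAt_nonneg (convex_Ici 0)
      (fun x _ => (hasDerivAt_sub_mul_deriv hφ x).continuousAt.continuousWithinAt)
      (fun x _ => (hasDerivAt_sub_mul_deriv hφ x).hasDerivWithinAt) fun x hx => ?_
    have hx : 0 ≤ x := interior_subset hx
    linarith [hnn x hx, congrArg (x * ·) (hODE x hx)]
  have hzero : (∫⁻ ρ in Ioi (0:ℝ), ENNReal.ofReal (ρ * q ρ * φ ρ)) = 0 →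
      ∀ r, 0 ≤ r → q r = 0 := by
    intro h0
    have hg : ∀ r, 0 ≤ r → φ r - r * deriv φ r = 0 := fun r hr => by
      refine le_antisymm ?_ (by simpa [hφ0] using hmono (mem_Ici.2 le_rfl) (mem_Ici.2 hr) hr)
      rw [← ENNReal.ofReal_eq_zero, ← lintegral_Ioc_eq_ofReal hφ hODE hφ0 hnn hr,
        ← nonpos_iff_eq_zero, ← h0]
      exact lintegral_mono_set Ioc_subset_Ioi_self
    have hqpos : ∀ r ∈ Ioi (0 : ℝ), q r = 0 := fun r hr => by
      have hr : 0 < r := hr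
      have hd : HasDerivAt (fun r => φ r - r * deriv φ r) 0 r :=
        (hasDerivAt_const r (0 : ℝ)).congr_of_eventuallyEq <| by
          filter_upwards [Ioi_mem_nhds hr] with x hx using hg x (le_of_lt hx)
      have h := (hasDerivAt_sub_mul_deriv hφ r).unique hd
      have h' : r * φ r * q r = 0 := by linear_combination r * hODE r hr.le + h
      exact (mul_eq_zero.1 h').resolve_left (mul_pos hr (hpos r hr)).ne'
    intro r hr
    exact EqOn.of_subset_closure (s := Ioi 0) (t := Ici 0) (f := q) (g := fun _ => 0) hqpos
      hq_cont continuousOn_const Ioi_subset_Ici_self (by rw [closure_Ioi]) hr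
  refine ⟨hmono, ?_, ⟨hzero, fun hq => ?_⟩, fun h0 r hr =>
    eq_id_of_coeff_eq_zero hφ hODE hφ0 hφ'0 (hzero h0) hr⟩
  · refine ((aecover_Iic (μ := volume.restrict (Ioi (0 : ℝ)))
      Filter.tendsto_id).lintegral_tendsto_of_countably_generated hmeas).congr' ?_
    filter_upwards [Filter.eventually_ge_atTop 0] with r hr
    rw [Measure.restrict_restrict measurableSet_Iic, inter_comm, id, Ioi_inter_Iic,
      lintegral_Ioc_eq_ofReal hφ hODE hφ0 hnn hr]
  · rw [setLIntegral_congr_fun (g := fun _ => 0) measurableSet_Ioi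
      fun x hx => by simp [hq x (le_of_lt hx)]]
    simp
end

section
/- Let r₋₁ > 0, r₀, φ₋₁ > 0, φ₀, s₂, s₃ be real constants. Let r : (0,∞) → (0,∞) be continuously differentiable with r(ρ) = r₋₁ ρ + r₀ + O(ρ^{−1}) and r'(ρ) = r₋₁ + O(ρ^{−2}) as ρ → ∞; let φ : (0,∞) → ℝ satisfy φ(t) = φ₋₁ t + φ₀ + O(t^{−1}) as t → ∞, and let σ : (0,∞) → ℝ satisfy σ(t) = s₂ t^{−2} + s₃ t^{−3} + O(t^{−4}) as t → ∞. Define φ̃(ρ) := φ(r(ρ)) and σ̃(ρ) := r'(ρ) σ(r(ρ)). Then φ̃(ρ) = φ̃₋₁ ρ + φ̃₀ + O(ρ^{−1}) with φ̃₋₁ = r₋₁ φ₋₁ > 0 and φ̃₀ = φ₀ + r₀ φ₋₁; σ̃(ρ) = s̃₂ ρ^{−2} + s̃₃ ρ^{−3} + O(ρ^{−4}) with s̃₂ = r₋₁^{−1} s₂ and s̃₃ = r₋₁^{−2}(s₃ − 2 r₀ s₂); and, setting τ₂ := −2φ₀/φ₋₁ and τ̃₂ := −2φ̃₀/φ̃₋₁,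 one has s̃₃ − τ̃₂ s̃₂ = r₋₁^{−2}(s₃ − τ₂ s₂). In particular s₃ = τ₂ s₂ holds if and only if s̃₃ = τ̃₂ s̃₂. -/
open MeasureTheory Set Filter Asymptotics

/-- The remainders in the expansions of `1 / r`, `1 / r ^ 2` and `1 / r ^ 3` for
`r ρ = c * ρ + d + O(1 / ρ)`. -/
theorem isBigO_one_div_of_affine_asymptotics {c d : ℝ} (hc : 0 < c) {r : ℝ → ℝ}
    (hr : (fun ρ => r ρ - (c * ρ + d)) =O[atTop] fun ρ => 1 / ρ) :
    Tendsto r atTop atTop ∧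
    ((fun ρ => 1 / r ρ) =O[atTop] fun ρ => 1 / ρ) ∧
    ((fun ρ => 1 / r ρ ^ 2 - (1 / c ^ 2 / ρ ^ 2 - 2 * d / c ^ 3 / ρ ^ 3)) =O[atTop]
      fun ρ => 1 / ρ ^ 4) ∧
    ((fun ρ => 1 / r ρ ^ 3 - 1 / c ^ 3 / ρ ^ 3) =O[atTop] fun ρ => 1 / ρ ^ 4) := by
  have hx0 : Tendsto (fun ρ : ℝ => 1 / ρ) atTop (nhds 0) := by
    simpa using tendsto_inv_atTop_zero (𝕜 := ℝ)
  have he0 := hr.trans_tendsto hx0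
  have hlow : ∀ᶠ ρ in atTop, c / 2 * ρ ≤ r ρ := by
    filter_upwards [he0.eventually (lt_mem_nhds (show (-1 : ℝ) < 0 by norm_num)),
      eventually_ge_atTop (2 / c * (1 - d))] with ρ h1 h2
    have h3 := mul_le_mul_of_nonneg_left h2 (half_pos hc).le
    have h4 : c / 2 * (2 / c * (1 - d)) = 1 - d := by field_simp
    linarith
  have htop : Tendsto r atTop atTop :=
    tendsto_atTop_mono' _ hlow (tendsto_id.const_mul_atTop (half_pos hc))
  have hy : (fun ρ => 1 / r ρ) =O[atTop] fun ρ => 1 / ρ := by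
    refine IsBigO.of_bound (2 / c) ?_
    filter_upwards [hlow, eventually_gt_atTop 0] with ρ h1 h2
    have h3 : 0 < c / 2 * ρ := by positivity
    rw [Real.norm_of_nonneg (one_div_nonneg.2 (h3.le.trans h1)),
      Real.norm_of_nonneg (one_div_nonneg.2 h2.le)]
    calc 1 / r ρ ≤ 1 / (c / 2 * ρ) := one_div_le_one_div_of_le h3 h1
      _ = 2 / c * (1 / ρ) := by field_simp
  have hne : ∀ᶠ ρ in atTop, ρ ≠ 0 ∧ r ρ ≠ 0 := by
    filter_upwards [eventually_ne_atTop 0, htop.eventually_ne_atTop 0] with ρ h1 h2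
    exact ⟨h1, h2⟩
  have hx : (fun ρ : ℝ => 1 / ρ) =O[atTop] fun ρ : ℝ => 1 / ρ := isBigO_refl _ _
  have hde : (fun ρ => d + (r ρ - (c * ρ + d))) =O[atTop] fun _ => (1 : ℝ) :=
    (isBigO_const_const _ one_ne_zero _).add (he0.isBigO_one ℝ)
  have hfirst : (fun ρ => 1 / r ρ - 1 / c * (1 / ρ)) =O[atTop] fun ρ => 1 / ρ ^ 2 := by
    refine (((hde.mul hx).mul hy).const_mul_left (-1 / c)).congr' ?_ (.of_forall fun ρ => by ring)
    filter_upwards [hne] with ρ ⟨h1, h2⟩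
    field_simp
    ring
  have hsecond : (fun ρ => 1 / r ρ - 1 / c * (1 / ρ) + d / c ^ 2 * (1 / ρ) ^ 2) =O[atTop]
      fun ρ => 1 / ρ ^ 3 := by
    have h1 := ((hr.mul hx).mul hy).const_mul_left (-1 / c)
    have h2 := (hx.mul hfirst).const_mul_left (-d / c)
    refine ((h1.congr_right (g₂ := fun ρ => 1 / ρ ^ 3) fun ρ => by ring).add
      (h2.congr_right fun ρ => by ring)).congr' ?_ .rfl
    filter_upwards [hne] with ρ ⟨h1, h2⟩
    field_simp
    ring
  refine ⟨htop, hy, ?_, ?_⟩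
  · have h1 := hsecond.mul (hy.add (hx.const_mul_left (1 / c)))
    have h2 := ((hx.pow 2).mul hfirst).const_mul_left (-d / c ^ 2)
    refine ((h1.congr_right (g₂ := fun ρ => 1 / ρ ^ 4) fun ρ => by ring).add
      (h2.congr_right fun ρ => by ring)).congr_left fun ρ => by ring
  · have h1 := (hy.pow 2).add (((hy.mul hx).const_mul_left (1 / c)).congr_right
      (g₂ := fun ρ => (1 / ρ) ^ 2) fun ρ => by ring)
    have h2 := h1.add ((hx.pow 2).const_mul_left (1 / c ^ 2))
    exact (hfirst.mul h2).congr (fun ρ => by ring) (fun ρ => by ring)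

/-- Gauge-invariance of the no-logs-condition: under a reparametrization
`ρ ↦ r(ρ) = r₋₁ ρ + r₀ + O(ρ⁻¹)` (with `r'(ρ) = r₋₁ + O(ρ⁻²)`), the conformal
factor `φ` transforms as a scalar and the shear component `σ` as a one-form,
the transformed expansion coefficients are as stated, and
`s̃₃ - τ̃₂ s̃₂ = r₋₁⁻² (s₃ - τ₂ s₂)`; in particular `s₃ = τ₂ s₂` iff
`s̃₃ = τ̃₂ s̃₂`.  Here `c1 = r₋₁`, `c0 = r₀`, `a = φ₋₁`, `b = φ₀`,
`τ₂ = -2 φ₀ / φ₋₁`. -/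
theorem stmt_13 (c1 c0 a b s₂ s₃ : ℝ) (hc1 : 0 < c1) (ha : 0 < a)
    (rfun φ σ : ℝ → ℝ)
    (hrpos : ∀ ρ, 0 < ρ → 0 < rfun ρ)
    (hrdiff : ∀ ρ, 0 < ρ → DifferentiableAt ℝ rfun ρ)
    (hrderiv_cont : ContinuousOn (deriv rfun) (Ioi 0))
    (hr_asympt : (fun ρ => rfun ρ - (c1 * ρ + c0)) =O[atTop] fun ρ => 1 / ρ)
    (hr'_asympt : (fun ρ => deriv rfun ρ - c1) =O[atTop] fun ρ => 1 / ρ ^ 2)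
    (hφ_asympt : (fun t => φ t - (a * t + b)) =O[atTop] fun t => 1 / t)
    (hσ_asympt : (fun t => σ t - (s₂ / t ^ 2 + s₃ / t ^ 3)) =O[atTop]
      fun t => 1 / t ^ 4) :
    ((fun ρ => φ (rfun ρ) - ((c1 * a) * ρ + (b + c0 * a))) =O[atTop]
      fun ρ => 1 / ρ) ∧
    0 < c1 * a ∧
    ((fun ρ => deriv rfun ρ * σ (rfun ρ)
        - (s₂ / c1 / ρ ^ 2 + (s₃ - 2 * c0 * s₂) / c1 ^ 2 / ρ ^ 3)) =O[atTop]
      fun ρ => 1 / ρ ^ 4) ∧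
    ((s₃ - 2 * c0 * s₂) / c1 ^ 2
        - (-(2 * (b + c0 * a)) / (c1 * a)) * (s₂ / c1)
      = (s₃ - (-(2 * b) / a) * s₂) / c1 ^ 2) ∧
    (s₃ = (-(2 * b) / a) * s₂ ↔
      (s₃ - 2 * c0 * s₂) / c1 ^ 2
        = (-(2 * (b + c0 * a)) / (c1 * a)) * (s₂ / c1)) := by
  obtain ⟨htop, hy, hy2, hy3⟩ := isBigO_one_div_of_affine_asymptotics hc1 hr_asympt
  have hcoeff : (s₃ - 2 * c0 * s₂) / c1 ^ 2
        - (-(2 * (b + c0 * a)) / (c1 * a)) * (s₂ / c1)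
      = (s₃ - (-(2 * b) / a) * s₂) / c1 ^ 2 := by
    field_simp
    ring
  refine ⟨?_, mul_pos hc1 ha, ?_, hcoeff, ?_⟩
  · have h1 := (hφ_asympt.comp_tendsto htop).trans hy
    exact (h1.add (hr_asympt.const_mul_left a)).congr_left fun ρ => by
      simp only [Function.comp_apply]
      ring
  · have hx0 : Tendsto (fun ρ : ℝ => 1 / ρ ^ 2) atTop (nhds 0) := by
      simpa using tendsto_pow_neg_atTop (𝕜 := ℝ) two_ne_zero
    have hr'_bdd : deriv rfun =O[atTop] fun _ => (1 : ℝ) :=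
      (((hr'_asympt.trans_tendsto hx0).isBigO_one ℝ).add
        (isBigO_const_const c1 one_ne_zero _)).congr_left fun ρ => by ring
    have hσ : (fun ρ => σ (rfun ρ) - (s₂ / rfun ρ ^ 2 + s₃ / rfun ρ ^ 3)) =O[atTop]
        fun ρ => 1 / ρ ^ 4 :=
      (hσ_asympt.comp_tendsto htop).trans
        ((hy.pow 4).congr (fun ρ => by simp) (fun ρ => by simp))
    have hy1 : (fun ρ => 1 / rfun ρ) =O[atTop] fun _ => (1 : ℝ) :=
      hy.trans ((tendsto_inv_atTop_zero (𝕜 := ℝ)).isBigO_one ℝ |>.congr_left fun ρ => by simp)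
    have hmain : (fun ρ => s₂ * (1 / rfun ρ) ^ 2 + s₃ * ((1 / rfun ρ) ^ 2 * (1 / rfun ρ)))
        =O[atTop] fun ρ => (1 / ρ) ^ 2 :=
      ((hy.pow 2).const_mul_left s₂).add
        ((((hy.pow 2).mul hy1).const_mul_left s₃).congr_right fun ρ => by ring)
    have h1 := (hr'_bdd.mul hσ).congr_right (g₂ := fun ρ => 1 / ρ ^ 4) fun ρ => by ring
    have h2 := (hr'_asympt.mul hmain).congr_right (g₂ := fun ρ => 1 / ρ ^ 4) fun ρ => by ring
    refine (((h1.add h2).add (hy2.const_mul_left (c1 * s₂))).add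
      (hy3.const_mul_left (c1 * s₃))).congr_left fun ρ => ?_
    have hc2 : 1 / c1 ^ 2 = c1 * (1 / c1 ^ 3) := by field_simp
    have hc : 1 / c1 = c1 * (1 / c1 ^ 2) := by field_simp
    rw [div_eq_mul_one_div s₂ c1, div_eq_mul_one_div _ (c1 ^ 2), hc]
    linear_combination (s₃ - 2 * c0 * s₂) / ρ ^ 3 * hc2
  · rw [← sub_eq_zero, ← sub_eq_zero (b := _ * (s₂ / c1)), hcoeff, div_eq_zero_iff]
    simp [hc1.ne']
end

section
/- Let φ₋₁ > 0, φ₀, φ̃₋₁ > 0, φ̃₀ be real constants. Let φ : (0,∞) → ℝ be continuously differentiable with φ(t) = φ₋₁ t + φ₀ + O(t^{−1}) and φ'(t) = φ₋₁ + O(t^{−2}) as t → ∞, and let r : (0,∞) → (0,∞) be a strictly increasing continuously differentiable bijection such that φ̃ := φ ∘ r satisfies φ̃(ρ) = φ̃₋₁ ρ + φ̃₀ + O(ρ^{−1}) and φ̃'(ρ) = φ̃₋₁ + O(ρ^{−2}) as ρ → ∞. Then r(ρ) = r₋₁ ρ + r₀ + O(ρ^{−1}) and r'(ρ) = r₋₁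 + O(ρ^{−2}) as ρ → ∞, where r₋₁ = φ̃₋₁/φ₋₁ > 0 and r₀ = (φ̃₀ − φ₀)/φ₋₁. -/
open MeasureTheory Set Filter Asymptotics

/-- A monotone function on `(0, ∞)` that is onto `(0, ∞)` tends to infinity. -/
theorem MonotoneOn.tendsto_atTop_of_surjOn_Ioi {f : ℝ → ℝ} (hf : MonotoneOn f (Ioi 0))
    (hs : SurjOn f (Ioi 0) (Ioi 0)) : Tendsto f atTop atTop := by
  refine tendsto_atTop.2 fun M => ?_
  obtain ⟨x, hx, hxM⟩ := hs (show max M 1 ∈ Ioi 0 from mem_Ioi.2 (lt_max_of_lt_right one_pos))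
  filter_upwards [eventually_ge_atTop x] with y hy
  exact (le_max_left M 1).trans (hxM ▸ hf hx (lt_of_lt_of_le hx hy) hy)

/-- Reparametrizations compatible with the asymptotic form of the conformal
factor: if `φ(t) = a t + b + O(t⁻¹)`, `φ'(t) = a + O(t⁻²)` (with `a > 0`) and a
strictly increasing `C¹` bijection `rfun : (0,∞) → (0,∞)` is such that
`φ ∘ rfun` has the analogous expansion with coefficients `ã > 0`, `b̃`, then
`rfun(ρ) = (ã/a) ρ + (b̃ - b)/a + O(ρ⁻¹)` and `rfun'(ρ) = ã/a + O(ρ⁻²)`.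
Here `a = φ₋₁`, `b = φ₀`, `at = φ̃₋₁`, `bt = φ̃₀`. -/
theorem stmt_14 (a b at' bt : ℝ) (ha : 0 < a) (hat : 0 < at')
    (φ rfun : ℝ → ℝ)
    (hφ_diff : ∀ t, 0 < t → DifferentiableAt ℝ φ t)
    (hφ_deriv_cont : ContinuousOn (deriv φ) (Ioi 0))
    (hφ_asympt : (fun t => φ t - (a * t + b)) =O[atTop] fun t => 1 / t)
    (hφ'_asympt : (fun t => deriv φ t - a) =O[atTop] fun t => 1 / t ^ 2)
    (hr_mono : StrictMonoOn rfun (Ioi 0))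
    (hr_bij : BijOn rfun (Ioi 0) (Ioi 0))
    (hr_diff : ∀ ρ, 0 < ρ → DifferentiableAt ℝ rfun ρ)
    (hr_deriv_cont : ContinuousOn (deriv rfun) (Ioi 0))
    (hφt_asympt : (fun ρ => φ (rfun ρ) - (at' * ρ + bt)) =O[atTop] fun ρ => 1 / ρ)
    (hφt'_asympt : (fun ρ => deriv (φ ∘ rfun) ρ - at') =O[atTop] fun ρ => 1 / ρ ^ 2) :
    ((fun ρ => rfun ρ - ((at' / a) * ρ + (bt - b) / a)) =O[atTop] fun ρ => 1 / ρ) ∧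
    ((fun ρ => deriv rfun ρ - at' / a) =O[atTop] fun ρ => 1 / ρ ^ 2) := by
  have hr : Tendsto rfun atTop atTop :=
    hr_mono.monotoneOn.tendsto_atTop_of_surjOn_Ioi hr_bij.surjOn
  have h_inv : Tendsto (fun t : ℝ => 1 / t) atTop (nhds 0) := by
    simpa using tendsto_inv_atTop_zero (𝕜 := ℝ)
  have h_inv_sq : Tendsto (fun t : ℝ => 1 / t ^ 2) atTop (nhds 0) := by
    simpa using h_inv.pow 2
  have hφr := hφ_asympt.comp_tendsto hr
  have hφ'r := hφ'_asympt.comp_tendsto hr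
  have h_lin : (fun ρ => a * rfun ρ - at' * ρ) =O[atTop] fun _ => (1 : ℝ) := by
    have h₁ := hφr.trans ((h_inv.comp hr).isBigO_one ℝ)
    have h₂ := hφt_asympt.trans (h_inv.isBigO_one ℝ)
    have h₃ : (fun _ : ℝ => bt - b) =O[atTop] fun _ => (1 : ℝ) := isBigO_const_const _ one_ne_zero _
    refine ((h₂.sub h₁).add h₃).congr_left fun ρ => ?_
    simp only [Function.comp_apply]
    ring
  have h_le : (fun ρ : ℝ => ρ) =O[atTop] rfun := by
    have h_equiv : IsEquivalent atTop (fun ρ => a * rfun ρ) fun ρ => at' * ρ := by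
      refine h_lin.trans_isLittleO ?_
      refine (isLittleO_const_left.2 (Or.inr ?_))
      exact tendsto_norm_atTop_atTop.comp (tendsto_id.const_mul_atTop hat)
    have h := h_equiv.isBigO_symm
    exact (isBigO_const_mul_left_iff hat.ne').1 ((isBigO_const_mul_right_iff ha.ne').1 h)
  have h_inv_le : (fun ρ => 1 / rfun ρ) =O[atTop] fun ρ => 1 / ρ := by
    simp only [one_div]
    refine h_le.inv_rev ?_
    filter_upwards [eventually_gt_atTop 0] with ρ hρ h0
    exact absurd h0 hρ.ne'
  have h_inv_sq_le : (fun ρ => 1 / rfun ρ ^ 2) =O[atTop] fun ρ => 1 / ρ ^ 2 := by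
    simpa using h_inv_le.pow 2
  constructor
  · refine ((hφt_asympt.sub (hφr.trans h_inv_le)).const_mul_left a⁻¹).congr_left fun ρ => ?_
    simp only [Function.comp_apply]
    field_simp
    ring
  · have h_chain : ∀ᶠ ρ in atTop, deriv (φ ∘ rfun) ρ = deriv φ (rfun ρ) * deriv rfun ρ := by
      filter_upwards [eventually_gt_atTop 0] with ρ hρ
      exact deriv_comp ρ (hφ_diff _ (hr_bij.mapsTo hρ)) (hr_diff ρ hρ)
    have h_lim : Tendsto (fun ρ => deriv φ (rfun ρ)) atTop (nhds a) :=
      tendsto_sub_nhds_zero_iff.1 (hφ'r.trans_tendsto (h_inv_sq.comp hr))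
    have h_limt : Tendsto (deriv (φ ∘ rfun)) atTop (nhds at') :=
      tendsto_sub_nhds_zero_iff.1 (hφt'_asympt.trans_tendsto h_inv_sq)
    have h_bdd : deriv rfun =O[atTop] fun _ => (1 : ℝ) := by
      refine ((h_limt.div h_lim ha.ne').isBigO_one ℝ).congr' ?_ EventuallyEq.rfl
      filter_upwards [h_chain, h_lim.eventually_ne ha.ne'] with ρ hρ hne
      simp only [Pi.div_apply, hρ]
      field_simp
    have h_prod : (fun ρ => deriv rfun ρ * (deriv φ (rfun ρ) - a)) =O[atTop]
        fun ρ => 1 / ρ ^ 2 := by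
      simpa using h_bdd.mul (hφ'r.trans h_inv_sq_le)
    refine ((hφt'_asympt.sub h_prod).const_mul_left a⁻¹).congr' ?_ EventuallyEq.rfl
    filter_upwards [h_chain] with ρ hρ
    rw [hρ]
    field_simp
    ring
end

section
/- Let S₂, S₃ be real 2×2 matrices, τ₂ ∈ ℝ, and let M : (0,∞) → M₂(ℝ) be a differentiable matrix-valued function with tr M(r) = 0 for all r, satisfying M(r) = S₂ r^{−2} + S₃ r^{−3} + O(r^{−4}) and M'(r) = −2S₂ r^{−3} − 3S₃ r^{−4} + O(r^{−5}) as r → ∞ (entrywise). Let τ, κ : (0,∞) → ℝ satisfy τ(r) = 2/r + τ₂ r^{−2} + O(r^{−3}) and κ(r) = O(r^{−3}) as r → ∞. Then ½ tr(M(r)²) I − M'(r) − (τ(r) − κ(r)) M(r) − M(r)² = (S₃ − τ₂ S₂) r^{−4} + O(r^{−5}) as r → ∞. In particular, the left-hand side is O(r^{−5}) if and only if S₃ = τ₂ S₂. -/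
open MeasureTheory Set Filter Asymptotics

theorem isBigO_one_div_pow_of_le {m n : ℕ} (h : m ≤ n) (c : ℝ) :
    (fun r : ℝ => c / r ^ n) =O[atTop] fun r => 1 / r ^ m := by
  refine IsBigO.of_bound |c| ?_
  filter_upwards [eventually_ge_atTop (1 : ℝ)] with r hr
  have hr0 : 0 < r := by linarith
  rw [Real.norm_eq_abs, Real.norm_eq_abs, abs_div, abs_of_pos (pow_pos hr0 n),
    abs_of_pos (one_div_pos.mpr (pow_pos hr0 m)), div_eq_mul_one_div]
  gcongr

theorem eq_zero_of_div_pow_isBigO {c : ℝ} {n : ℕ}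
    (h : (fun r : ℝ => c / r ^ n) =O[atTop] fun r => 1 / r ^ (n + 1)) : c = 0 := by
  have hc : (fun _ : ℝ => c) =O[atTop] fun r : ℝ => r⁻¹ := by
    refine (h.mul (isBigO_refl (fun r : ℝ => r ^ n) atTop)).congr' ?_ ?_ <;>
      filter_upwards [eventually_gt_atTop (0 : ℝ)] with r hr
    · field_simp
    · field_simp
      exact (pow_succ r n).symm
  exact tendsto_nhds_unique tendsto_const_nhds (hc.trans_tendsto tendsto_inv_atTop_zero)

theorem Matrix.half_trace_sq_smul_one_eq_sq {A : Matrix (Fin 2) (Fin 2) ℝ}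
    (hA : A.trace = 0) :
    (1 / 2 * (A * A).trace) • (1 : Matrix (Fin 2) (Fin 2) ℝ) = A * A := by
  rw [Matrix.trace_fin_two] at hA
  have h : A 1 1 = -A 0 0 := by linarith
  ext i j
  fin_cases i <;> fin_cases j <;>
    simp [Matrix.trace_fin_two, Matrix.mul_apply, Fin.sum_univ_two, h] <;> ring

/-- The scalar expansion behind the no-logs-condition. -/
theorem isBigO_neg_deriv_sub_mul_sub {a b c : ℝ} {f f' τ κ : ℝ → ℝ}
    (hf : (fun r => f r - (a / r ^ 2 + b / r ^ 3)) =O[atTop] fun r => 1 / r ^ 4)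
    (hf' : (fun r => f' r - (-2 * a / r ^ 3 + -3 * b / r ^ 4)) =O[atTop]
      fun r => 1 / r ^ 5)
    (hτ : (fun r => τ r - (2 / r + c / r ^ 2)) =O[atTop] fun r => 1 / r ^ 3)
    (hκ : κ =O[atTop] fun r => 1 / r ^ 3) :
    (fun r => -f' r - (τ r - κ r) * f r - (b - c * a) / r ^ 4) =O[atTop]
      fun r => 1 / r ^ 5 := by
  have hf2 : f =O[atTop] fun r => 1 / r ^ 2 := by
    refine ((hf.trans (isBigO_one_div_pow_of_le (by norm_num : 2 ≤ 4) 1)).add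
      ((isBigO_one_div_pow_of_le le_rfl a).add
        (isBigO_one_div_pow_of_le (by norm_num : 2 ≤ 3) b))).congr_left fun r => ?_
    ring
  have hd : (fun r : ℝ => 2 / r ^ 1 + c / r ^ 2) =O[atTop] fun r => 1 / r ^ 1 :=
    (isBigO_one_div_pow_of_le le_rfl 2).add (isBigO_one_div_pow_of_le (by norm_num) c)
  have h₁ := (hd.mul hf).congr_right (g₂ := fun r => 1 / r ^ 5) fun r => by
    rw [one_div_mul_one_div, ← pow_add]
  have h₂ := ((hτ.sub hκ).mul hf2).congr_right (g₂ := fun r => 1 / r ^ 5) fun r => by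
    rw [one_div_mul_one_div, ← pow_add]
  refine (((hf'.neg_left.sub h₁).sub h₂).sub
    (isBigO_one_div_pow_of_le le_rfl (c * b))).congr' ?_ EventuallyEq.rfl
  filter_upwards [eventually_gt_atTop (0 : ℝ)] with r hr
  field_simp
  ring

/-- Geometric interpretation of the no-logs-condition: for a trace-free
matrix field `M(r) = S₂ r⁻² + S₃ r⁻³ + O(r⁻⁴)` (the shear `σ_A{}^B`) with
`M'(r) = -2 S₂ r⁻³ - 3 S₃ r⁻⁴ + O(r⁻⁵)`, divergence
`τ(r) = 2/r + τ₂ r⁻² + O(r⁻³)` and `κ = O(r⁻³)`, the Weyl-tensor expression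
`½ tr(M²) I - M' - (τ - κ) M - M²` equals `(S₃ - τ₂ S₂) r⁻⁴ + O(r⁻⁵)`
entrywise; in particular it is `O(r⁻⁵)` iff `S₃ = τ₂ S₂`. -/
theorem stmt_15 (S₂ S₃ : Matrix (Fin 2) (Fin 2) ℝ) (τ₂ : ℝ)
    (M M' : ℝ → Matrix (Fin 2) (Fin 2) ℝ) (τ κ : ℝ → ℝ)
    (hM_deriv : ∀ (i j : Fin 2) (r : ℝ), 0 < r →
      HasDerivAt (fun t => M t i j) (M' r i j) r)
    (hM_trace : ∀ r : ℝ, 0 < r → Matrix.trace (M r) = 0)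
    (hM_asympt : ∀ i j : Fin 2,
      (fun r => M r i j - (S₂ i j / r ^ 2 + S₃ i j / r ^ 3)) =O[atTop]
        fun r => 1 / r ^ 4)
    (hM'_asympt : ∀ i j : Fin 2,
      (fun r => M' r i j - (-2 * S₂ i j / r ^ 3 + -3 * S₃ i j / r ^ 4)) =O[atTop]
        fun r => 1 / r ^ 5)
    (hτ : (fun r => τ r - (2 / r + τ₂ / r ^ 2)) =O[atTop] fun r => 1 / r ^ 3)
    (hκ : κ =O[atTop] fun r => 1 / r ^ 3) :
    (∀ i j : Fin 2,
      (fun r => ((1 / 2 * Matrix.trace (M r * M r)) • (1 : Matrix (Fin 2) (Fin 2) ℝ)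
          - M' r - (τ r - κ r) • M r - M r * M r) i j
          - (S₃ - τ₂ • S₂) i j / r ^ 4) =O[atTop] fun r => 1 / r ^ 5) ∧
    ((∀ i j : Fin 2,
      (fun r => ((1 / 2 * Matrix.trace (M r * M r)) • (1 : Matrix (Fin 2) (Fin 2) ℝ)
          - M' r - (τ r - κ r) • M r - M r * M r) i j) =O[atTop]
        fun r => 1 / r ^ 5) ↔
      S₃ = τ₂ • S₂) := by
  have key : ∀ i j : Fin 2,
      (fun r => ((1 / 2 * Matrix.trace (M r * M r)) • (1 : Matrix (Fin 2) (Fin 2) ℝ)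
          - M' r - (τ r - κ r) • M r - M r * M r) i j
          - (S₃ - τ₂ • S₂) i j / r ^ 4) =O[atTop] fun r => 1 / r ^ 5 := by
    intro i j
    refine (isBigO_neg_deriv_sub_mul_sub (hM_asympt i j) (hM'_asympt i j) hτ hκ).congr' ?_
      EventuallyEq.rfl
    filter_upwards [eventually_gt_atTop (0 : ℝ)] with r hr
    rw [Matrix.half_trace_sq_smul_one_eq_sq (hM_trace r hr)]
    simp only [Matrix.sub_apply, Matrix.smul_apply, smul_eq_mul]
    ring
  refine ⟨key, fun h => ?_, fun h i j => ?_⟩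
  · ext i j
    refine sub_eq_zero.mp (eq_zero_of_div_pow_isBigO (n := 4) ?_)
    refine ((h i j).sub (key i j)).congr_left fun r => ?_
    rw [sub_sub_cancel, Matrix.sub_apply]
  · simpa [h] using key i j
end

section
/- Let n ≥ 2 be an integer, let κ : [0,∞) → ℝ be continuous with H(r) := ∫₀^r κ(ρ) dρ, let φ : (0,∞) → (0,∞) be continuously differentiable, and let W, P : (0,∞) → ℝ be continuous such that ρ ↦ e^{H(ρ)} φ(ρ)^{(n−1)/2} (P(ρ) − W(ρ)) is integrable on (0, r) for each r > 0. Define ν(r) := ½ e^{−H(r)} φ(r)^{−(n−1)/2} ∫₀^r e^{H(ρ)} φ(ρ)^{(n−1)/2} (P(ρ) − W(ρ)) dρ and τ := (n−1) φ'/φ. Then ν satisfies ν'(r) + ½ (W(r) − P(r)) + ν(r) (τ(r)/2 + κ(r)) = 0 for all r > 0; and if W(r) < P(r) for all r > 0, then ν(r) > 0 for all r > 0. -/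
open MeasureTheory Set

open scoped Topology

/-- The fundamental theorem of calculus on `(0, ∞)` for an integrand that may be singular at `0`. -/
theorem hasDerivAt_intervalIntegral_of_continuousOn_Ioi {f : ℝ → ℝ} {r : ℝ} (hr : 0 < r)
    (hf : ContinuousOn f (Ioi 0)) (hint : IntegrableOn f (Ioc 0 r)) :
    HasDerivAt (fun x => ∫ t in (0:ℝ)..x, f t) (f r) r :=
  intervalIntegral.integral_hasDerivAt_right
    ((intervalIntegrable_iff_integrableOn_Ioc_of_le hr.le).2 hint)
    (hf.stronglyMeasurableAtFilter isOpen_Ioi r hr)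
    (hf.continuousAt (Ioi_mem_nhds hr))

/-- An integrable function that is positive on `(0, ∞)` has positive integral over `(0, r]`. -/
theorem setIntegral_Ioc_pos_of_pos {f : ℝ → ℝ} {r : ℝ} (hr : 0 < r)
    (hint : IntegrableOn f (Ioc 0 r)) (hpos : ∀ x, 0 < x → 0 < f x) :
    0 < ∫ t in Ioc (0:ℝ) r, f t := by
  rw [← intervalIntegral.integral_of_le hr.le]
  exact intervalIntegral.intervalIntegral_pos_of_pos_on
    ((intervalIntegrable_iff_integrableOn_Ioc_of_le hr.le).2 hint) (fun x hx => hpos x hx.1) hr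

/-- Solution formula for the metric component `ν⁰`: with
`ν(r) = ½ e^{-H(r)} φ(r)^{-(n-1)/2} ∫₀^r e^{H} φ^{(n-1)/2} (P - W)`,
one has `ν' + ½ (W - P) + ν (τ/2 + κ) = 0` where `τ = (n-1) φ'/φ`; and if
`W < P` on `(0,∞)` then `ν > 0` on `(0,∞)`. -/
theorem stmt_16 (n : ℕ) (hn : 2 ≤ n) (κ φ W P ν : ℝ → ℝ)
    (hκ : ContinuousOn κ (Ici 0))
    (H : ℝ → ℝ) (hH : ∀ r, H r = ∫ ρ in (0:ℝ)..r, κ ρ)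
    (hφpos : ∀ r, 0 < r → 0 < φ r)
    (hφC1 : ∀ r, 0 < r → DifferentiableAt ℝ φ r)
    (hφderiv_cont : ContinuousOn (deriv φ) (Ioi 0))
    (hW : ContinuousOn W (Ioi 0))
    (hP : ContinuousOn P (Ioi 0))
    (hint : ∀ r, 0 < r → IntegrableOn
      (fun ρ => Real.exp (H ρ) * φ ρ ^ (((n : ℝ) - 1) / 2) * (P ρ - W ρ))
      (Ioc 0 r))
    (hν : ∀ r, ν r = 1 / 2 * Real.exp (-H r) * φ r ^ (-(((n : ℝ) - 1) / 2)) *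
      ∫ ρ in Ioc (0:ℝ) r,
        Real.exp (H ρ) * φ ρ ^ (((n : ℝ) - 1) / 2) * (P ρ - W ρ)) :
    (∀ r, 0 < r →
      deriv ν r + 1 / 2 * (W r - P r)
        + ν r * ((((n : ℝ) - 1) * deriv φ r / φ r) / 2 + κ r) = 0) ∧
    ((∀ r, 0 < r → W r < P r) → ∀ r, 0 < r → 0 < ν r) := by
  set a : ℝ := ((n : ℝ) - 1) / 2 with ha
  set f : ℝ → ℝ := fun ρ => Real.exp (H ρ) * φ ρ ^ a * (P ρ - W ρ) with hf
  have hHd : ∀ r, 0 < r → HasDerivAt H (κ r) r := fun r hr => by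
    rw [funext hH]
    exact hasDerivAt_intervalIntegral_of_continuousOn_Ioi hr (hκ.mono Ioi_subset_Ici_self)
      (((hκ.mono Icc_subset_Ici_self).integrableOn_Icc).mono_set Ioc_subset_Icc_self)
  have hφd : ∀ b r, 0 < r →
      HasDerivAt (fun x => φ x ^ b) (deriv φ r * b * φ r ^ (b - 1)) r :=
    fun b r hr => (hφC1 r hr).hasDerivAt.rpow_const (Or.inl (hφpos r hr).ne')
  have hfc : ContinuousOn f (Ioi 0) := by
    refine ContinuousOn.mul (ContinuousOn.mul ?_ ?_) (hP.sub hW)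
    · exact fun r hr => (hHd r hr).continuousAt.rexp.continuousWithinAt
    · exact fun r hr => (hφd a r hr).continuousAt.continuousWithinAt
  refine ⟨fun r hr => ?_, fun hWP r hr => ?_⟩
  · have hφr := hφpos r hr
    have hd := (((hHd r hr).neg.exp.const_mul (1 / 2)).mul (hφd (-a) r hr)).mul
      (hasDerivAt_intervalIntegral_of_continuousOn_Ioi hr hfc (hint r hr))
    have hνeq : ν =ᶠ[𝓝 r] fun x => 1 / 2 * Real.exp (-H x) * φ x ^ (-a) *
        ∫ t in (0:ℝ)..x, f t := by
      filter_upwards [Ioi_mem_nhds hr] with x hx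
      rw [hν x, intervalIntegral.integral_of_le (le_of_lt hx)]
    have hderiv := (hd.congr_of_eventuallyEq hνeq).deriv
    have hna : (n : ℝ) - 1 = 2 * a := by rw [ha]; ring
    have hexp : Real.exp (-H r) * Real.exp (H r) = 1 := by rw [← Real.exp_add]; simp
    have hpow : φ r ^ (-a) * φ r ^ a = 1 := by rw [← Real.rpow_add hφr]; simp
    rw [hderiv, hνeq.eq_of_nhds, hna, Real.rpow_sub_one hφr.ne']
    simp only [hf, Pi.neg_apply, Pi.mul_apply]
    generalize (∫ t in (0:ℝ)..r, Real.exp (H t) * φ t ^ a * (P t - W t)) = I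
    field_simp
    linear_combination (φ r * (P r - W r)) * (φ r ^ (-a) * φ r ^ a * hexp + hpow)
  · rw [hν r]
    have hI := setIntegral_Ioc_pos_of_pos hr (hint r hr) fun x hx =>
      mul_pos (mul_pos (Real.exp_pos _) (Real.rpow_pos_of_pos (hφpos x hx) _))
        (sub_pos.2 (hWP x hx))
    have := Real.rpow_pos_of_pos (hφpos r hr) (-a)
    positivity
end

section
/- Let n ≥ 2 be an integer, let κ : [0,∞) → ℝ be continuous such that the improper integral β := lim_{r→∞} ∫₀^r κ(ρ) dρ exists in ℝ, and set H(r) := ∫₀^r κ(ρ) dρ. Let φ : (0,∞) → (0,∞) be continuous with φ(r)/r → φ₋₁ for some φ₋₁ > 0 as r → ∞, and let F : (0,∞) → ℝ be continuous such that ρ ↦ e^{H(ρ)} φ(ρ)^{(n−1)/2} F(ρ) is integrable on (0, r) for each r > 0 and r F(r) → α ∈ ℝ as r → ∞. Then ν(r) := ½ e^{−H(r)} φ(r)^{−(n−1)/2} ∫₀^r e^{H(ρ)} φ(ρ)^{(n−1)/2} F(ρ) dρ converges to α/(n−1) as r → ∞. -/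
open MeasureTheory Set

/-- If `g` is locally integrable up to `0` and `g(r) = o(r^{p-1})` with `p > 0`, then
`∫₀^r g = o(r^p)`. -/
theorem isLittleO_integral_rpow {g : ℝ → ℝ} {p : ℝ} (hp : 0 < p)
    (hg : ∀ r, 0 < r → IntervalIntegrable g volume 0 r)
    (ho : g =o[Filter.atTop] fun r : ℝ => r ^ (p - 1)) :
    (fun r => ∫ ρ in (0:ℝ)..r, g ρ) =o[Filter.atTop] fun r : ℝ => r ^ p := by
  rw [Asymptotics.isLittleO_iff]
  intro ε hε
  obtain ⟨R₀, hR₀⟩ := Filter.eventually_atTop.1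
    ((Asymptotics.isLittleO_iff.1 ho) (by positivity : 0 < ε / 2 * p))
  set R := max R₀ 1
  have hRpos : 0 < R := lt_of_lt_of_le one_pos (le_max_right _ _)
  have hlarge := (tendsto_rpow_atTop hp).eventually_ge_atTop
    (‖∫ ρ in (0:ℝ)..R, g ρ‖ / (ε / 2))
  filter_upwards [hlarge, Filter.eventually_ge_atTop R] with r hr hRr
  have hrpos : 0 < r := hRpos.trans_le hRr
  have hsplit := intervalIntegral.integral_add_adjacent_intervals (hg R hRpos)
    ((hg R hRpos).symm.trans (hg r hrpos))
  have hpow : IntervalIntegrable (fun ρ : ℝ => ε / 2 * p * ρ ^ (p - 1)) volume R r :=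
    (intervalIntegral.intervalIntegrable_rpow' (by linarith)).const_mul _
  have htail : ‖∫ ρ in R..r, g ρ‖ ≤ ∫ ρ in R..r, ε / 2 * p * ρ ^ (p - 1) := by
    refine intervalIntegral.norm_integral_le_of_norm_le hRr (ae_of_all _ fun ρ hρ => ?_) hpow
    have hρpos : 0 < ρ := hRpos.trans hρ.1
    have := hR₀ ρ ((le_max_left _ _).trans hρ.1.le)
    rwa [Real.norm_of_nonneg (Real.rpow_nonneg hρpos.le _)] at this
  have hvalue : ∫ ρ in R..r, ε / 2 * p * ρ ^ (p - 1) = ε / 2 * (r ^ p - R ^ p) := by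
    rw [intervalIntegral.integral_const_mul, integral_rpow (Or.inl (by linarith))]
    simp only [sub_add_cancel]
    field_simp
  rw [div_le_iff₀ (by positivity)] at hr
  rw [← hsplit, Real.norm_of_nonneg (Real.rpow_nonneg hrpos.le _)]
  have hRp : 0 < R ^ p := Real.rpow_pos_of_pos hRpos p
  have := norm_add_le (∫ ρ in (0:ℝ)..R, g ρ) (∫ ρ in R..r, g ρ)
  nlinarith [mul_pos hε hRp]

/-- If `r^{1-p} g(r) → L` with `p > 0`, then `r^{-p} ∫₀^r g → L / p`. -/
theorem tendsto_integral_div_rpow {g : ℝ → ℝ} {p L : ℝ} (hp : 0 < p)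
    (hg : ∀ r, 0 < r → IntervalIntegrable g volume 0 r)
    (hL : Filter.Tendsto (fun r => g r / r ^ (p - 1)) Filter.atTop (nhds L)) :
    Filter.Tendsto (fun r => (∫ ρ in (0:ℝ)..r, g ρ) / r ^ p) Filter.atTop (nhds (L / p)) := by
  have hpow (r : ℝ) : IntervalIntegrable (fun ρ : ℝ => L * ρ ^ (p - 1)) volume 0 r :=
    (intervalIntegral.intervalIntegrable_rpow' (by linarith)).const_mul _
  have ho : (fun r => g r - L * r ^ (p - 1)) =o[Filter.atTop] fun r : ℝ => r ^ (p - 1) := by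
    refine (Asymptotics.isLittleO_iff_tendsto' ?_).2 ?_
    · filter_upwards [Filter.eventually_gt_atTop 0] with r hr h
      exact absurd h (Real.rpow_pos_of_pos hr _).ne'
    · have := hL.sub_const L
      rw [sub_self] at this
      refine this.congr' ?_
      filter_upwards [Filter.eventually_gt_atTop 0] with r hr
      have := (Real.rpow_pos_of_pos hr (p - 1)).ne'
      field_simp
  have key := (isLittleO_integral_rpow hp (fun r hr => (hg r hr).sub (hpow r))
    ho).tendsto_div_nhds_zero.add_const (L / p)
  rw [zero_add] at key
  refine key.congr' ?_
  filter_upwards [Filter.eventually_gt_atTop 0] with r hr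
  have hrp := (Real.rpow_pos_of_pos hr p).ne'
  rw [intervalIntegral.integral_sub (hg r hr) (hpow r), intervalIntegral.integral_const_mul,
    integral_rpow (Or.inl (by linarith))]
  simp only [sub_add_cancel, Real.zero_rpow hp.ne']
  field_simp
  ring

/-- Asymptotics of the metric component `ν⁰`: if `H(r) = ∫₀^r κ → β`,
`φ(r)/r → φ₋₁ > 0` and `r F(r) → α`, then
`ν(r) = ½ e^{-H(r)} φ(r)^{-(n-1)/2} ∫₀^r e^{H} φ^{(n-1)/2} F → α/(n-1)`. -/
theorem stmt_17 (n : ℕ) (hn : 2 ≤ n) (κ φ F : ℝ → ℝ) (β c α : ℝ)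
    (hκ : ContinuousOn κ (Ici 0))
    (H : ℝ → ℝ) (hH : ∀ r, H r = ∫ ρ in (0:ℝ)..r, κ ρ)
    (hβ : Filter.Tendsto H Filter.atTop (nhds β))
    (hφ_cont : ContinuousOn φ (Ioi 0))
    (hφpos : ∀ r, 0 < r → 0 < φ r)
    (hc : 0 < c)
    (hφlim : Filter.Tendsto (fun r => φ r / r) Filter.atTop (nhds c))
    (hF_cont : ContinuousOn F (Ioi 0))
    (hint : ∀ r, 0 < r → IntegrableOn
      (fun ρ => Real.exp (H ρ) * φ ρ ^ (((n : ℝ) - 1) / 2) * F ρ) (Ioc 0 r))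
    (hFlim : Filter.Tendsto (fun r => r * F r) Filter.atTop (nhds α)) :
    Filter.Tendsto
      (fun r => 1 / 2 * Real.exp (-H r) * φ r ^ (-(((n : ℝ) - 1) / 2)) *
        ∫ ρ in Ioc (0:ℝ) r, Real.exp (H ρ) * φ ρ ^ (((n : ℝ) - 1) / 2) * F ρ)
      Filter.atTop (nhds (α / ((n : ℝ) - 1))) := by
  have hn' : (2 : ℝ) ≤ n := by exact_mod_cast hn
  have hp : 0 < ((n : ℝ) - 1) / 2 := by linarith
  have hn1 : (n : ℝ) - 1 = 2 * (((n : ℝ) - 1) / 2) := by ring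
  rw [show α / ((n : ℝ) - 1) = α / (2 * (((n : ℝ) - 1) / 2)) by rw [← hn1]]
  generalize ((n : ℝ) - 1) / 2 = p at *
  have hexp : Filter.Tendsto (fun r => Real.exp (H r)) Filter.atTop (nhds (Real.exp β)) :=
    (Real.continuous_exp.tendsto β).comp hβ
  have hφp : Filter.Tendsto (fun r => (φ r / r) ^ p) Filter.atTop (nhds (c ^ p)) :=
    hφlim.rpow_const (Or.inl hc.ne')
  have hcp : c ^ p ≠ 0 := (Real.rpow_pos_of_pos hc p).ne'
  have hsource : Filter.Tendsto
      (fun r => Real.exp (H r) * φ r ^ p * F r / r ^ (p - 1)) Filter.atTop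
      (nhds (Real.exp β * c ^ p * α)) := by
    refine ((hexp.mul hφp).mul hFlim).congr' ?_
    filter_upwards [Filter.eventually_gt_atTop 0] with r hr
    have hrp := (Real.rpow_pos_of_pos hr p).ne'
    rw [Real.div_rpow (hφpos r hr).le hr.le, Real.rpow_sub_one hr.ne']
    field_simp
  have hmean := tendsto_integral_div_rpow hp
    (fun r hr => (intervalIntegrable_iff_integrableOn_Ioc_of_le hr.le).2 (hint r hr)) hsource
  have hprod := ((hexp.mul hφp).inv₀ (mul_ne_zero (Real.exp_pos β).ne' hcp)).mul
    (hmean.const_mul (1 / 2))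
  have hlim : (Real.exp β * c ^ p)⁻¹ * (1 / 2 * (Real.exp β * c ^ p * α / p))
      = α / (2 * p) := by
    have := (Real.exp_pos β).ne'
    field_simp
  rw [hlim] at hprod
  refine hprod.congr' ?_
  filter_upwards [Filter.eventually_gt_atTop 0] with r hr
  have hrp := (Real.rpow_pos_of_pos hr p).ne'
  have hφr := (Real.rpow_pos_of_pos (hφpos r hr) p).ne'
  have hexpr := (Real.exp_pos (H r)).ne'
  rw [intervalIntegral.integral_of_le hr.le, Real.div_rpow (hφpos r hr).le hr.le,
    Real.exp_neg, Real.rpow_neg (hφpos r hr).le]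
  field_simp
end
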